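/- arXiv:math/9801089 — 4 statements merged into one kernel-verified Lean document; each statement's English description precedes it below -/
import Mathlib

section
/- Let n ≥ 1 be an integer and a a nonzero real number. Let P be the real matrix with rows and columns indexed by the elements of S_n whose (u,v) entry is C(a + n − 1 − d(v∘u⁻¹), n)/a^n. Then the characteristic polynomial of P equals ∏_{i=0}^{n−1} (X − a^{−i})^{m_i}, where m_i is the number of permutations in S_n having exactly n − i cycles (fixed points counted as cycles). In particular the eigenvalues of P are 1/a^i for 0 ≤ i ≤ n−1, the eigenvalue 1/a^i occurring with multiplicity m_i. -/
/-- The generalized binomial coefficient `C(t, n) = t(t-1)⋯(t-n+1)/n!`. -/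
noncomputable def genBinom (t : ℝ) (n : ℕ) : ℝ :=
  (∏ i ∈ Finset.range n, (t - i)) / Nat.factorial n

/-- The number of descents of a permutation `w` of `{0, 1, …, n-1}`:
the number of indices `i` with `i + 1 < n` and `w (i+1) < w i`. -/
noncomputable def numDescents {n : ℕ} (w : Equiv.Perm (Fin n)) : ℕ :=
  Nat.card {i : ℕ // ∃ h : i + 1 < n, w ⟨i + 1, h⟩ < w ⟨i, Nat.lt_of_succ_lt h⟩}

/-- The number of cycles of a permutation, counting fixed points as cycles. -/
noncomputable def numCycles {n : ℕ} (w : Equiv.Perm (Fin n)) : ℕ :=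
  Multiset.card w.cycleType + (Finset.univ.filter fun i => w i = i).card


open Finset in
theorem card_strictMono_fin (n M : ℕ) :
    Nat.card {F : Fin n → Fin M // StrictMono F} = M.choose n := by
  let e : {F : Fin n → Fin M // StrictMono F} ≃ (Fin n ↪o Fin M) :=
    { toFun := fun F => OrderEmbedding.ofStrictMono F.1 F.2
      invFun := fun f => ⟨f, f.strictMono⟩
      left_inv := fun F => by ext; simp
      right_inv := fun f => by ext; simp }
  rw [Nat.card_congr (e.trans Set.powersetCard.ofFinEmbEquiv), Set.powersetCard.card]
  simp

theorem eq_sort_iff_step {k : ℕ} {α : Type*} [LinearOrder α] (g : Fin (k+1) → α)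
    (w : Equiv.Perm (Fin (k+1))) :
    w = Tuple.sort g ↔ ∀ i : Fin k, g (w i.castSucc) < g (w i.succ) ∨
      (g (w i.castSucc) = g (w i.succ) ∧ w i.castSucc < w i.succ) := by
  rw [Tuple.eq_sort_iff', Fin.strictMono_iff_lt_succ]
  refine forall_congr' fun i => ?_
  exact Prod.Lex.toLex_lt_toLex

/-- ascents before position `j` -/
def ascBefore {k : ℕ} (w : Equiv.Perm (Fin (k+1))) (j : Fin (k+1)) : ℕ :=
  (Finset.univ.filter fun i : Fin k => i.castSucc < j ∧ w i.castSucc < w i.succ).card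

theorem ascBefore_succ {k : ℕ} (w : Equiv.Perm (Fin (k+1))) (i : Fin k) :
    ascBefore w i.succ = ascBefore w i.castSucc + if w i.castSucc < w i.succ then 1 else 0 := by
  unfold ascBefore
  have : (Finset.univ.filter fun j : Fin k => j.castSucc < i.succ ∧ w j.castSucc < w j.succ) =
      (Finset.univ.filter fun j : Fin k => j.castSucc < i.castSucc ∧ w j.castSucc < w j.succ) ∪
      (if w i.castSucc < w i.succ then {i} else ∅) := by
    ext j
    have h : j.castSucc < i.succ ↔ j.castSucc < i.castSucc ∨ j = i := by
      simp only [Fin.lt_def, Fin.ext_iff, Fin.val_castSucc, Fin.val_succ]; omega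
    simp only [Finset.mem_filter, Finset.mem_univ, true_and, Finset.mem_union, h]
    split_ifs with hh
    · simp only [Finset.mem_singleton]
      constructor
      · rintro ⟨h1 | h1, h2⟩
        · exact Or.inl ⟨h1, h2⟩
        · exact Or.inr h1
      · rintro (⟨h1, h2⟩ | h1)
        · exact ⟨Or.inl h1, h2⟩
        · subst h1; exact ⟨Or.inr rfl, hh⟩
    · simp only [Finset.notMem_empty, or_false]
      constructor
      · rintro ⟨h1 | h1, h2⟩
        · exact ⟨h1, h2⟩
        · subst h1; exact absurd h2 hh
      · rintro ⟨h1, h2⟩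
        exact ⟨Or.inl h1, h2⟩
  rw [this, Finset.card_union_of_disjoint]
  · split_ifs <;> simp
  · split_ifs <;> simp

theorem ascBefore_zero {k : ℕ} (w : Equiv.Perm (Fin (k+1))) : ascBefore w 0 = 0 := by
  simp [ascBefore]

theorem ascBefore_last_add {k : ℕ} (w : Equiv.Perm (Fin (k+1))) :
    ascBefore w (Fin.last k) + numDescents w = k := by
  have h1 : numDescents w = (Finset.univ.filter fun i : Fin k => ¬ w i.castSucc < w i.succ).card := by
    unfold numDescents
    rw [← Fintype.card_subtype, ← Nat.card_eq_fintype_card]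
    refine Nat.card_congr
      { toFun := fun i => ⟨⟨i.1, by obtain ⟨h, _⟩ := i.2; omega⟩, ?_⟩
        invFun := fun i => ⟨i.1.1, by have := i.1.2; omega, ?_⟩
        left_inv := fun i => rfl
        right_inv := fun i => rfl }
    · obtain ⟨h, h'⟩ := i.2
      exact not_lt.2 h'.le
    · have h := i.2
      rcases lt_or_eq_of_le (not_lt.1 h) with h' | h'
      · exact h'
      · have := w.injective h'
        simp [Fin.ext_iff] at this
  have h2 : ascBefore w (Fin.last k) = (Finset.univ.filter fun i : Fin k => w i.castSucc < w i.succ).card := by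
    simp [ascBefore, Fin.castSucc_lt_last]
  rw [h1, h2, Finset.card_filter_add_card_filter_not]
  simp

theorem count_sort {k : ℕ} (a : ℕ) (w : Equiv.Perm (Fin (k+1))) :
    Nat.card {g : Fin (k+1) → Fin a // Tuple.sort g = w} =
      (a + ascBefore w (Fin.last k)).choose (k+1) := by
  rw [← card_strictMono_fin]
  have hle : ∀ j, ascBefore w j ≤ ascBefore w (Fin.last k) := by
    intro j
    have : Monotone (ascBefore w) := by
      rw [Fin.monotone_iff_le_succ]; intro i; rw [ascBefore_succ]; omega
    exact this (Fin.le_last j)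
  have hF : ∀ F : Fin (k+1) → Fin (a + ascBefore w (Fin.last k)), StrictMono F →
      (∀ j, ascBefore w j ≤ (F j : ℕ)) ∧ ∀ j, (F j : ℕ) < a + ascBefore w j := by
    intro F hF
    have h1 : Monotone (fun j => ((F j : ℕ) : ℤ) - ascBefore w j) := by
      rw [Fin.monotone_iff_le_succ]; intro i
      have := hF (Fin.castSucc_lt_succ (i := i))
      rw [Fin.lt_def] at this
      rw [ascBefore_succ]; split_ifs <;> push_cast <;> omega
    constructor
    · intro j
      have := h1 (Fin.zero_le j)
      simp only [ascBefore_zero] at this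
      omega
    · intro j
      have := h1 (Fin.le_last j)
      have h2 := (F (Fin.last k)).2
      simp only at this
      omega
  refine Nat.card_congr 
    { toFun := fun g => ⟨fun j => ⟨g.1 (w j) + ascBefore w j, by
          have := (g.1 (w j)).2; have := hle j; omega⟩, ?_⟩
      invFun := fun F => ⟨fun x => ⟨(F.1 (w.symm x) : ℕ) - ascBefore w (w.symm x), by
          have h1 := (hF F.1 F.2).1 (w.symm x); have h2 := (hF F.1 F.2).2 (w.symm x); omega⟩, ?_⟩
      left_inv := ?_
      right_inv := ?_ }
  · rw [Fin.strictMono_iff_lt_succ]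
    intro i
    have := (eq_sort_iff_step g.1 w).1 g.2.symm i
    simp only [Fin.lt_def, Fin.ext_iff, ascBefore_succ] at this ⊢
    split_ifs <;> omega
  · rw [eq_comm, eq_sort_iff_step]
    intro i
    have h0 := F.2 (Fin.castSucc_lt_succ (i := i))
    have h1 := (hF F.1 F.2).1 i.castSucc
    have h2 := (hF F.1 F.2).1 i.succ
    simp only [Fin.lt_def, Fin.ext_iff, Equiv.symm_apply_apply] at h0 ⊢
    rw [ascBefore_succ] at h2 ⊢
    simp only [Fin.lt_def] at h2 ⊢
    split_ifs at h2 ⊢ <;> omega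
  · intro g
    ext x
    simp
  · intro F
    ext x
    have h1 := (hF F.1 F.2).1 x
    simp [h1]

theorem genBinom_nat (m n : ℕ) : genBinom m n = m.choose n := by
  unfold genBinom
  rw [Nat.choose_eq_descFactorial_div_factorial, Nat.cast_div (Nat.factorial_dvd_descFactorial _ _) (by positivity)]
  congr 1
  rw [← descPochhammer_eval_eq_descFactorial, descPochhammer_eval_eq_prod_range]
open Polynomial in

theorem det_aeval_eq {N : Type*} [Fintype N] [DecidableEq N] (A : Matrix N N ℂ) (q : ℂ[X]) :
    (aeval A q).det = (A.charpoly.roots.map (fun l => q.eval l)).prod := by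
  have hcard : Multiset.card A.charpoly.roots = Fintype.card N := by
    rw [← (IsAlgClosed.splits A.charpoly).natDegree_eq_card_roots, A.charpoly_natDegree_eq_dim]
  have hlin : ∀ c : ℂ, (aeval A (X - C c)).det = (A.charpoly.roots.map (fun l => (X - C c).eval l)).prod := by
    intro c
    have h1 : A.charpoly.eval c = (A.charpoly.roots.map (fun l => c - l)).prod := by
      conv_lhs => rw [(IsAlgClosed.splits A.charpoly).eq_prod_roots_of_monic A.charpoly_monic]
      rw [eval_multiset_prod, Multiset.map_map]
      simp
    rw [Matrix.eval_charpoly] at h1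
    have h2 : aeval A (X - C c) = -(Matrix.scalar N c - A) := by
      simp [Algebra.algebraMap_eq_smul_one, Matrix.smul_one_eq_diagonal]
    rw [h2, Matrix.det_neg, h1, ← hcard]
    rw [← Multiset.card_map (fun l => c - l), ← Multiset.prod_map_neg]
    rw [Multiset.map_map]
    simp
  have hconst : ∀ c : ℂ, (aeval A (C c)).det = (A.charpoly.roots.map (fun l => (C c).eval l)).prod := by
    intro c
    simp [Algebra.algebraMap_eq_smul_one, hcard]
  have hmul : ∀ p r : ℂ[X], (aeval A p).det = (A.charpoly.roots.map (fun l => p.eval l)).prod →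
      (aeval A r).det = (A.charpoly.roots.map (fun l => r.eval l)).prod →
      (aeval A (p * r)).det = (A.charpoly.roots.map (fun l => (p * r).eval l)).prod := by
    intro p r hp hr
    simp only [map_mul, Matrix.det_mul, hp, hr, eval_mul, Multiset.prod_map_mul]
  rw [(IsAlgClosed.splits q).eq_prod_roots]
  apply hmul _ _ (hconst _)
  generalize q.roots = s
  induction s using Multiset.induction_on with
  | empty => simp
  | cons c s ih =>
    rw [Multiset.map_cons, Multiset.prod_cons]
    exact hmul _ _ (hlin c) ih

open Polynomial in
theorem trace_pow_eq {N : Type*} [Fintype N] [DecidableEq N] (A : Matrix N N ℂ) (m : ℕ) :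
    (A ^ m).trace = (A.charpoly.roots.map (fun l => l ^ m)).sum := by
  have h : (A ^ m).charpoly = ((A.charpoly.roots.map (fun l => l ^ m)).map (fun l => X - C l)).prod := by
    apply Polynomial.funext
    intro s
    rw [Matrix.eval_charpoly, eval_multiset_prod, Multiset.map_map, Multiset.map_map]
    have := det_aeval_eq A (C s - X ^ m)
    simpa [Algebra.algebraMap_eq_smul_one, Matrix.smul_one_eq_diagonal] using this
  rw [Matrix.trace_eq_sum_roots_charpoly, h, Polynomial.roots_multiset_prod_X_sub_C]

open Polynomial in
theorem multiset_eq_of_psum (s t : Multiset ℂ)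
    (h : ∀ m : ℕ, (s.map (fun l => l ^ m)).sum = (t.map (fun l => l ^ m)).sum) : s = t := by
  classical
  have hp : ∀ p : ℂ[X], (s.map (fun l => p.eval l)).sum = (t.map (fun l => p.eval l)).sum := by
    intro p
    induction p using Polynomial.induction_on' with
    | add p q hp hq => simp [Multiset.sum_map_add, hp, hq]
    | monomial m c => simp [Multiset.sum_map_mul_left, h]
  have key : ∀ (x : ℂ) (F : Finset ℂ) (u : Multiset ℂ), (∀ y ∈ u, y ∈ F) →
      (u.map (fun l => (∏ y ∈ F.erase x, (X - C y) : ℂ[X]).eval l)).sum =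
        u.count x * (∏ y ∈ F.erase x, (X - C y) : ℂ[X]).eval x := by
    intro x F u
    induction u using Multiset.induction_on with
    | empty => simp
    | cons z u ih =>
      intro hu
      rw [Multiset.map_cons, Multiset.sum_cons, ih (fun y hy => hu y (Multiset.mem_cons_of_mem hy)),
        Multiset.count_cons]
      by_cases hz : x = z
      · subst hz; simp; ring
      · have : (∏ y ∈ F.erase x, (X - C y) : ℂ[X]).eval z = 0 := by
          rw [eval_prod]
          apply Finset.prod_eq_zero (i := z)
          · simp [Ne.symm hz, hu z (Multiset.mem_cons_self z u)]
          · simp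
        rw [this, if_neg hz]; simp
  ext x
  have h1 := key x (s + t).toFinset s (by intro y hy; simp [hy])
  have h2 := key x (s + t).toFinset t (by intro y hy; simp [hy])
  rw [hp, h2] at h1
  have hne : (∏ y ∈ (s + t).toFinset.erase x, (X - C y) : ℂ[X]).eval x ≠ 0 := by
    rw [eval_prod, Finset.prod_ne_zero_iff]
    intro y hy
    have := (Finset.mem_erase.mp hy).1
    simp [sub_ne_zero, this.symm]
  exact_mod_cast (mul_right_cancel₀ hne h1).symm

open Polynomial in
theorem charpoly_eq_of_trace {N : Type*} [Fintype N] [DecidableEq N] (A : Matrix N N ℝ) (d : N → ℝ)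
    (h : ∀ m : ℕ, (A ^ m).trace = ∑ i, d i ^ m) :
    A.charpoly = ∏ i, (X - C (d i)) := by
  apply Polynomial.map_injective (algebraMap ℝ ℂ) (algebraMap ℝ ℂ).injective
  rw [← Matrix.charpoly_map]
  have hs : (A.map (algebraMap ℝ ℂ)).charpoly.roots = (Finset.univ.val.map (fun i => (d i : ℂ))) := by
    apply multiset_eq_of_psum
    intro m
    rw [← trace_pow_eq, ← Matrix.map_pow, Multiset.map_map]
    have := congrArg (algebraMap ℝ ℂ) (h m)
    rw [AddMonoidHom.map_trace] at this
    rw [show (A ^ m).map (algebraMap ℝ ℂ) = ((algebraMap ℝ ℂ) : ℝ →+ ℂ).mapMatrix (A ^ m) from rfl]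
    simpa using this
  rw [(IsAlgClosed.splits (A.map (algebraMap ℝ ℂ)).charpoly).eq_prod_roots_of_monic (Matrix.charpoly_monic _), hs,
    Multiset.map_map, Polynomial.map_prod]
  simp

theorem sort_comp_strictMono {n : ℕ} {α β : Type*} [LinearOrder α] [LinearOrder β]
    (g : Fin n → α) (e : α → β) (he : StrictMono e) : Tuple.sort (e ∘ g) = Tuple.sort g := by
  rw [eq_comm, Tuple.eq_sort_iff]
  have h := (Tuple.eq_sort_iff (f := g) (σ := Tuple.sort g)).1 rfl
  exact ⟨he.monotone.comp h.1, fun i j hij h' => h.2 i j hij (he.injective h')⟩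

theorem sort_lex {n : ℕ} {α β : Type*} [LinearOrder α] [LinearOrder β]
    (g : Fin n → α) (h : Fin n → β) :
    Tuple.sort (fun x => toLex (h ((Tuple.sort g).symm x), g x) : Fin n → β ×ₗ α) =
      Tuple.sort g * Tuple.sort h := by
  rw [eq_comm, Tuple.eq_sort_iff]
  have hg := (Tuple.eq_sort_iff (f := g) (σ := Tuple.sort g)).1 rfl
  have hh := (Tuple.eq_sort_iff (f := h) (σ := Tuple.sort h)).1 rfl
  have key : ∀ i j, i < j → (h (Tuple.sort h i) < h (Tuple.sort h j)) ∨
      (h (Tuple.sort h i) = h (Tuple.sort h j) ∧ Tuple.sort h i < Tuple.sort h j) := by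
    intro i j hij
    rcases lt_or_eq_of_le (hh.1 hij.le) with h1 | h1
    · exact Or.inl h1
    · exact Or.inr ⟨h1, hh.2 i j hij h1⟩
  constructor
  · intro i j hij
    rcases eq_or_lt_of_le hij with rfl | hij
    · exact le_rfl
    simp only [Function.comp, Equiv.Perm.mul_apply, Equiv.symm_apply_apply, Prod.Lex.toLex_le_toLex]
    rcases key i j hij with h1 | ⟨h1, h2⟩
    · exact Or.inl h1
    · exact Or.inr ⟨h1, hg.1 h2.le⟩
  · intro i j hij he
    simp only [Equiv.Perm.mul_apply, Equiv.symm_apply_apply, toLex_inj, Prod.mk.injEq] at he ⊢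
    rcases key i j hij with h1 | ⟨h1, h2⟩
    · exact absurd he.1 h1.ne
    · exact hg.2 _ _ h2 he.2

/-- number of words whose stable sorting permutation is `w` -/
noncomputable def cntSort {n : ℕ} (α : Type*) [LinearOrder α] (w : Equiv.Perm (Fin n)) : ℕ :=
  Nat.card {g : Fin n → α // Tuple.sort g = w}

theorem cntSort_eq_sum {n : ℕ} (α : Type*) [LinearOrder α] [Fintype α] (w : Equiv.Perm (Fin n)) :
    cntSort α w = ∑ g : Fin n → α, if Tuple.sort g = w then 1 else 0 := by
  classical
  rw [cntSort, Nat.card_eq_fintype_card, Fintype.card_subtype, Finset.card_filter]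

theorem cntSort_congr {n : ℕ} {α β : Type*} [LinearOrder α] [LinearOrder β] (e : α ≃o β)
    (w : Equiv.Perm (Fin n)) : cntSort α w = cntSort β w := by
  refine Nat.card_congr (Equiv.subtypeEquiv (Equiv.piCongrRight fun _ => e.toEquiv) fun g => ?_)
  rw [← sort_comp_strictMono g e e.strictMono]
  rfl

theorem cntSort_lex {n : ℕ} (α β : Type*) [LinearOrder α] [Fintype α] [LinearOrder β] [Fintype β]
    (w : Equiv.Perm (Fin n)) :
    cntSort (β ×ₗ α) w = ∑ y : Equiv.Perm (Fin n), cntSort α y * cntSort β (y⁻¹ * w) := by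
  classical
  let e : ((Fin n → α) × (Fin n → β)) ≃ (Fin n → β ×ₗ α) :=
    { toFun := fun p x => toLex (p.2 ((Tuple.sort p.1).symm x), p.1 x)
      invFun := fun k => (fun x => (ofLex (k x)).2,
        fun x => (ofLex (k (Tuple.sort (fun x => (ofLex (k x)).2) x))).1)
      left_inv := fun p => by simp
      right_inv := fun k => by ext x <;> simp }
  have h1 : cntSort (β ×ₗ α) w = Nat.card {p : (Fin n → α) × (Fin n → β) //
      Tuple.sort p.1 * Tuple.sort p.2 = w} := by
    symm
    refine Nat.card_congr (Equiv.subtypeEquiv e fun p => ?_)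
    rw [← sort_lex]
    rfl
  rw [h1, Nat.card_eq_fintype_card, Fintype.card_subtype, Finset.card_filter, Fintype.sum_prod_type]
  simp only [cntSort_eq_sum, Finset.sum_mul]
  conv_rhs => rw [Finset.sum_comm]
  refine Finset.sum_congr rfl fun g _ => ?_
  simp only [ite_mul, one_mul, zero_mul]
  rw [Finset.sum_ite_eq]
  simp only [Finset.mem_univ, if_true]
  refine Finset.sum_congr rfl fun h _ => ?_
  simp only [eq_inv_mul_iff_mul_eq]

theorem cntSort_mul {n : ℕ} (a b : ℕ) (w : Equiv.Perm (Fin n)) :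
    cntSort (Fin (b * a)) w =
      ∑ y : Equiv.Perm (Fin n), cntSort (Fin a) y * cntSort (Fin b) (y⁻¹ * w) := by
  rw [← cntSort_lex]
  exact cntSort_congr (Fintype.orderIsoFinOfCardEq (Fin b ×ₗ Fin a)
    (by rw [Fintype.card_lex]; simp)) w

theorem genBinom_eq_cntSort {k : ℕ} (a : ℕ) (w : Equiv.Perm (Fin (k+1))) :
    genBinom ((a:ℝ) + (k+1:ℕ) - 1 - numDescents w) (k+1) = cntSort (Fin a) w := by
  rw [cntSort, count_sort, ← genBinom_nat]
  congr 1
  have : (ascBefore w (Fin.last k) : ℝ) + numDescents w = k := by exact_mod_cast ascBefore_last_add w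
  push_cast
  linarith

open Polynomial in
/-- polynomial version of genBinom -/
noncomputable def gPoly (n : ℕ) (c : ℝ) : ℝ[X] :=
  C ((Nat.factorial n : ℝ)⁻¹) * ∏ i ∈ Finset.range n, (X + C (c - i))

theorem gPoly_eval (n : ℕ) (c t : ℝ) : (gPoly n c).eval t = genBinom (t + c) n := by
  simp only [gPoly, genBinom, Polynomial.eval_mul, Polynomial.eval_C, Polynomial.eval_prod,
    Polynomial.eval_add, Polynomial.eval_X, div_eq_inv_mul]
  congr 1
  refine Finset.prod_congr rfl fun i _ => by ring

theorem poly_eq_of_nat (p q : Polynomial ℝ) (h : ∀ m : ℕ, p.eval (m:ℝ) = q.eval (m:ℝ)) : p = q := by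
  apply Polynomial.eq_of_infinite_eval_eq
  refine Set.Infinite.mono ?_ (Set.infinite_range_of_injective (Nat.cast_injective (R := ℝ)))
  rintro _ ⟨m, rfl⟩
  exact h m

open Polynomial in
theorem genBinom_conv {k : ℕ} (s t : ℝ) (w : Equiv.Perm (Fin (k+1))) :
    ∑ y : Equiv.Perm (Fin (k+1)), genBinom (t + (k+1:ℕ) - 1 - numDescents y) (k+1) *
      genBinom (s + (k+1:ℕ) - 1 - numDescents (y⁻¹ * w)) (k+1) =
    genBinom (s * t + (k+1:ℕ) - 1 - numDescents w) (k+1) := by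
  let p : Equiv.Perm (Fin (k+1)) → ℝ[X] := fun w => gPoly (k+1) ((k+1:ℕ) - 1 - numDescents w)
  have hp : ∀ w (t : ℝ), genBinom (t + (k+1:ℕ) - 1 - numDescents w) (k+1) = (p w).eval t := by
    intro w t
    rw [gPoly_eval]; congr 1; ring
  have hnat : ∀ a b : ℕ, ∑ y, (p y).eval (a:ℝ) * (p (y⁻¹ * w)).eval (b:ℝ) = (p w).eval ((b:ℝ) * a) := by
    intro a b
    have := cntSort_mul a b w
    have h2 : ((cntSort (Fin (b * a)) w : ℕ) : ℝ) = _ := congrArg Nat.cast this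
    push_cast at h2
    rw [← genBinom_eq_cntSort] at h2
    simp only [← genBinom_eq_cntSort, hp] at h2
    rw [← h2]; push_cast; rfl
  have h1 : ∀ (a : ℕ) (s : ℝ), ∑ y, (p y).eval (a:ℝ) * (p (y⁻¹ * w)).eval s = (p w).eval (s * a) := by
    intro a s
    have := poly_eq_of_nat (∑ y, C ((p y).eval (a:ℝ)) * (p (y⁻¹ * w))) ((p w).comp (X * C (a:ℝ)))
      (by intro m; simpa [eval_finsetSum] using hnat a m)
    have := congrArg (eval s) this
    simpa [eval_finsetSum] using this
  have h2 := poly_eq_of_nat (∑ y, (p y) * C ((p (y⁻¹ * w)).eval s)) ((p w).comp (C s * X))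
      (by intro m; simpa [eval_finsetSum] using h1 m s)
  have := congrArg (eval t) h2
  simp only [hp]
  simpa [eval_finsetSum] using this

/-- unnormalized matrix -/
noncomputable def qMat (k : ℕ) (t : ℝ) : Matrix (Equiv.Perm (Fin (k+1))) (Equiv.Perm (Fin (k+1))) ℝ :=
  Matrix.of fun u v => genBinom (t + (k+1:ℕ) - 1 - numDescents (v * u⁻¹)) (k+1)

theorem qMat_mul (k : ℕ) (s t : ℝ) : qMat k s * qMat k t = qMat k (s * t) := by
  ext u v
  rw [Matrix.mul_apply]
  simp only [qMat, Matrix.of_apply]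
  rw [← genBinom_conv]
  refine Fintype.sum_equiv ((Equiv.inv _).trans (Equiv.mulLeft v)) _ _ fun x => ?_
  simp [mul_assoc, mul_comm]

theorem qMat_pow (k : ℕ) (t : ℝ) (m : ℕ) : qMat k t ^ (m+1) = qMat k (t ^ (m+1)) := by
  induction m with
  | zero => simp
  | succ m ih => rw [pow_succ, ih, qMat_mul, ← pow_succ]

theorem card_quotient_sameCycle {n : ℕ} (w : Equiv.Perm (Fin n)) :
    Nat.card (Quotient (Equiv.Perm.SameCycle.setoid w)) = numCycles w := by
  classical
  let T : Finset (Equiv.Perm (Fin n) ⊕ Fin n) :=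
    w.cycleFactorsFinset.disjSum (Finset.univ.filter fun i => w i = i)
  have hT : T.card = numCycles w := by
    rw [Finset.card_disjSum, numCycles, Equiv.Perm.cycleType_def]
    simp
  let φ : Fin n → Equiv.Perm (Fin n) ⊕ Fin n := fun x =>
    if w x = x then Sum.inr x else Sum.inl (w.cycleOf x)
  have hφT : ∀ x, φ x ∈ T := by
    intro x
    by_cases hx : w x = x
    · simp [φ, T, hx]
    · simp [φ, T, hx, Equiv.Perm.cycleOf_mem_cycleFactorsFinset_iff]
  have hφ : ∀ x y, w.SameCycle x y ↔ φ x = φ y := by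
    intro x y
    by_cases hx : w x = x
    · by_cases hy : w y = y
      · simp only [φ, hx, hy, if_true, Sum.inr.injEq]
        constructor
        · rintro h; exact (h.eq_of_left hx)
        · rintro rfl; exact Equiv.Perm.SameCycle.refl _ _
      · simp only [φ, hx, hy, if_true, if_false, reduceCtorEq, iff_false]
        intro h
        exact hy ((h.apply_eq_self_iff).1 hx)
    · by_cases hy : w y = y
      · simp only [φ, hx, hy, if_true, if_false, reduceCtorEq, iff_false]
        intro h
        exact hx ((h.apply_eq_self_iff).2 hy)
      · simp only [φ, hx, hy, if_false, Sum.inl.injEq]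
        exact Equiv.Perm.sameCycle_iff_cycleOf_eq_of_mem_support
          (Equiv.Perm.mem_support.2 hx) (Equiv.Perm.mem_support.2 hy)
  let ψ : Quotient (Equiv.Perm.SameCycle.setoid w) → T :=
    Quotient.lift (fun x => (⟨φ x, hφT x⟩ : T)) (fun x y h => Subtype.ext ((hφ x y).1 h))
  have hψ : Function.Bijective ψ := by
    constructor
    · intro p q
      refine Quotient.inductionOn₂ p q fun x y h => ?_
      exact Quotient.sound ((hφ x y).2 (congrArg Subtype.val h))
    · rintro ⟨z, hz⟩
      rcases z with c | x
      · have hc : c ∈ w.cycleFactorsFinset := by simpa [T] using hz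
        have hcyc := (Equiv.Perm.mem_cycleFactorsFinset_iff.1 hc).1
        obtain ⟨x, hx⟩ := hcyc.nonempty_support
        have h1 := Equiv.Perm.cycle_is_cycleOf hx hc
        have h2 : w x ≠ x := Equiv.Perm.mem_support.1
          (Equiv.Perm.mem_cycleFactorsFinset_support_le hc hx)
        refine ⟨Quotient.mk _ x, Subtype.ext ?_⟩
        change φ x = _
        simp [φ, h2, ← h1]
      · have hc : w x = x := by simpa [T] using hz
        refine ⟨Quotient.mk _ x, Subtype.ext ?_⟩
        change φ x = _
        simp [φ, hc]
  rw [← hT, Nat.card_congr (Equiv.ofBijective ψ hψ)]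
  simp

theorem numCycles_le {n : ℕ} (w : Equiv.Perm (Fin n)) : numCycles w ≤ n := by
  rw [← card_quotient_sameCycle]
  have := Nat.card_le_card_of_surjective
    (Quotient.mk (Equiv.Perm.SameCycle.setoid w)) Quotient.mk_surjective
  simpa using this

theorem numCycles_pos {n : ℕ} (hn : 1 ≤ n) (w : Equiv.Perm (Fin n)) : 1 ≤ numCycles w := by
  rw [← card_quotient_sameCycle]
  have : Nonempty (Quotient (Equiv.Perm.SameCycle.setoid w)) := ⟨Quotient.mk _ ⟨0, hn⟩⟩
  exact Nat.card_pos

theorem card_fixed_words {n : ℕ} (q : ℕ) (w : Equiv.Perm (Fin n)) :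
    Nat.card {f : Fin n → Fin q // f ∘ w = f} = q ^ numCycles w := by
  have hconst : ∀ f : Fin n → Fin q, f ∘ w = f → ∀ x y, w.SameCycle x y → f x = f y := by
    intro f hf x y h
    obtain ⟨i, hi⟩ := h.exists_nat_pow_eq
    rw [← hi]
    clear hi
    induction i with
    | zero => simp
    | succ i ih =>
      rw [pow_succ', Equiv.Perm.mul_apply, ih]
      exact (congrFun hf _).symm
  let e : {f : Fin n → Fin q // f ∘ w = f} ≃ (Quotient (Equiv.Perm.SameCycle.setoid w) → Fin q) :=
    { toFun := fun f => Quotient.lift f.1 (fun x y h => hconst f.1 f.2 x y h)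
      invFun := fun F => ⟨fun x => F (Quotient.mk _ x), by
        funext x
        refine congrArg F (Quotient.sound ?_)
        exact Equiv.Perm.sameCycle_apply_left.2 (Equiv.Perm.SameCycle.refl _ _)⟩
      left_inv := fun f => rfl
      right_inv := fun F => by
        funext z
        exact Quotient.inductionOn z fun x => rfl }
  rw [Nat.card_congr e, Nat.card_fun, card_quotient_sameCycle, Nat.card_fin]

theorem sum_fixed_words (n q : ℕ) :
    ∑ w : Equiv.Perm (Fin n), q ^ numCycles w = Nat.factorial n * cntSort (Fin q) (1 : Equiv.Perm (Fin n)) := by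
  classical
  have h1 : ∀ w : Equiv.Perm (Fin n), q ^ numCycles w =
      ∑ f : Fin n → Fin q, if f ∘ w = f then 1 else 0 := by
    intro w
    rw [← card_fixed_words, Nat.card_eq_fintype_card, Fintype.card_subtype, Finset.card_filter]
  have h2 : ∀ f : Fin n → Fin q, (∑ w : Equiv.Perm (Fin n), if f ∘ w = f then 1 else 0) =
      ∑ s : Equiv.Perm (Fin n), if Monotone (f ∘ s) then 1 else 0 := by
    intro f
    refine Fintype.sum_equiv (Equiv.mulRight (Tuple.sort f)) _ _ fun w => ?_
    refine if_congr ?_ rfl rfl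
    rw [← Tuple.comp_sort_eq_comp_iff_monotone, Equiv.coe_mulRight, Equiv.Perm.coe_mul,
      ← Function.comp_assoc]
    exact ((Tuple.sort f).surjective.injective_comp_right.eq_iff).symm
  have h3 : ∀ s : Equiv.Perm (Fin n), (∑ f : Fin n → Fin q, if Monotone (f ∘ s) then 1 else 0) =
      cntSort (Fin q) (1 : Equiv.Perm (Fin n)) := by
    intro s
    rw [cntSort_eq_sum]
    refine Fintype.sum_equiv (s.symm.arrowCongr (Equiv.refl _)) _ _ fun f => ?_
    refine if_congr ?_ rfl rfl
    rw [Equiv.Perm.one_def, Tuple.sort_eq_refl_iff_monotone]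
    rfl
  simp only [h1]
  rw [Finset.sum_comm]
  simp only [h2]
  rw [Finset.sum_comm]
  simp only [h3]
  simp [Fintype.card_perm]

open Polynomial in
theorem trace_qMat (k : ℕ) (t : ℝ) :
    (qMat k t).trace = ∑ w : Equiv.Perm (Fin (k+1)), t ^ numCycles w := by
  have h1 : (qMat k t).trace = Nat.factorial (k+1) *
      genBinom (t + (k+1:ℕ) - 1 - numDescents (1 : Equiv.Perm (Fin (k+1)))) (k+1) := by
    simp [Matrix.trace, qMat, Fintype.card_perm]
  rw [h1]
  have h2 := poly_eq_of_nat
    (C (Nat.factorial (k+1) : ℝ) * gPoly (k+1) ((k+1:ℕ) - 1 - numDescents (1 : Equiv.Perm (Fin (k+1)))))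
    (∑ w : Equiv.Perm (Fin (k+1)), X ^ numCycles w) (by
      intro m
      have := sum_fixed_words (k+1) m
      have h3 : ((∑ w : Equiv.Perm (Fin (k+1)), m ^ numCycles w : ℕ) : ℝ) = _ := congrArg Nat.cast this
      rw [Nat.cast_mul, ← genBinom_eq_cntSort] at h3
      rw [eval_mul, eval_C, gPoly_eval, eval_finsetSum]
      simp only [eval_pow, eval_X]
      push_cast at h3 ⊢
      rw [h3]
      congr 2
      ring)
  have h3 := congrArg (eval t) h2
  rw [eval_mul, eval_C, gPoly_eval, eval_finsetSum] at h3
  simp only [eval_pow, eval_X] at h3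
  rw [← h3]
  congr 2
  ring

/-- The characteristic polynomial of the transition matrix of the `a`-riffle
shuffle walk on `Sₙ` equals `∏_{i=0}^{n-1} (X - a⁻ⁱ)^{mᵢ}`, where `mᵢ` is the
number of permutations in `Sₙ` with exactly `n - i` cycles (fixed points
counted as cycles). -/
theorem charpoly_riffle_transition_matrix (n : ℕ) (hn : 1 ≤ n) (a : ℝ) (ha : a ≠ 0)
    (P : Matrix (Equiv.Perm (Fin n)) (Equiv.Perm (Fin n)) ℝ)
    (hP : ∀ u v : Equiv.Perm (Fin n),
      P u v = genBinom (a + n - 1 - numDescents (v * u⁻¹)) n / a ^ n) :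
    P.charpoly = ∏ i ∈ Finset.range n,
      (Polynomial.X - Polynomial.C ((a ^ i)⁻¹)) ^
        (Finset.univ.filter fun w : Equiv.Perm (Fin n) => numCycles w = n - i).card := by
  obtain ⟨k, rfl⟩ : ∃ k, n = k + 1 := ⟨n - 1, by omega⟩
  have hPQ : P = (a ^ (k+1))⁻¹ • qMat k a := by
    ext u v
    rw [hP, Matrix.smul_apply, qMat, Matrix.of_apply, smul_eq_mul, div_eq_inv_mul]
  have htr : ∀ m : ℕ, (P ^ m).trace =
      ∑ w : Equiv.Perm (Fin (k+1)), ((a ^ (k + 1 - numCycles w))⁻¹) ^ m := by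
    intro m
    rcases m with _ | m
    · simp
    · rw [hPQ, smul_pow, qMat_pow, Matrix.trace_smul, trace_qMat, smul_eq_mul, Finset.mul_sum]
      refine Finset.sum_congr rfl fun w _ => ?_
      have h1 : a ^ (k+1) = a ^ (k + 1 - numCycles w) * a ^ numCycles w := by
        rw [← pow_add, Nat.sub_add_cancel (numCycles_le w)]
      rw [h1, ← pow_mul, mul_comm (m+1), pow_mul, ← mul_pow]
      congr 1
      field_simp
  rw [charpoly_eq_of_trace P _ htr]
  rw [← Finset.prod_fiberwise_of_maps_to (s := Finset.univ) (t := Finset.range (k+1))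
    (g := fun w : Equiv.Perm (Fin (k+1)) => k + 1 - numCycles w)
    (fun w _ => by
      have := numCycles_pos hn w
      simp only [Finset.mem_range]; omega)]
  refine Finset.prod_congr rfl fun i hi => ?_
  rw [Finset.prod_congr rfl (g := fun _ => Polynomial.X - Polynomial.C ((a ^ i)⁻¹))
    (fun w hw => by rw [(Finset.mem_filter.1 hw).2]), Finset.prod_const]
  congr 2
  ext w
  have h1 := numCycles_pos hn w
  have h2 := numCycles_le w
  have h3 := Finset.mem_range.1 hi
  simp only [Finset.mem_filter, Finset.mem_univ, true_and]
  omega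
end

section
/- Let n ≥ 2, let (W,S) be a Coxeter system whose Coxeter matrix is of type B_n (so |S| = n, consecutive generators braid with m = 3 except for one end pair with m = 4), and suppose W is finite. Then for every real number x, ∑_{w ∈ W} C((x−1)/2 + n − d(w), n) = x^n. -/
/-- The number of (right) descents of an element `w` of a Coxeter group:
the number of simple reflections `s` with `ℓ(w s) < ℓ(w)`. -/
noncomputable def coxNumDescents {B W : Type*} [Group W] [Fintype B]
    {M : CoxeterMatrix B} (cs : CoxeterSystem M W) (w : W) : ℕ :=
  (Finset.univ.filter fun i : B => cs.length (w * cs.simple i) < cs.length w).card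


namespace RB
variable {n : ℕ}
def cr (i : Fin n) : Fin n → ℤ :=
  if h : (i : ℕ) + 1 < n then Pi.single i 1 - Pi.single ⟨i + 1, h⟩ 1 else Pi.single i 2
def al (i : Fin n) : (Fin n → ℤ) →ₗ[ℤ] ℤ :=
  if h : (i : ℕ) + 1 < n then LinearMap.proj i - LinearMap.proj ⟨i + 1, h⟩ else LinearMap.proj i
def rf (i : Fin n) : Module.End ℤ (Fin n → ℤ) := LinearMap.id - (al i).smulRight (cr i)

lemma rf_apply (i : Fin n) (v : Fin n → ℤ) : rf i v = v - al i v • cr i := by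
  simp [rf]

lemma al_apply (i : Fin n) (v : Fin n → ℤ) :
    al i v = if h : (i : ℕ) + 1 < n then v i - v ⟨i + 1, h⟩ else v i := by
  unfold al; split_ifs <;> simp

lemma cr_apply (i a : Fin n) :
    cr i a = if (i : ℕ) + 1 < n then (if a = i then 1 else if (a : ℕ) = i + 1 then -1 else 0)
      else if a = i then 2 else 0 := by
  unfold cr
  split_ifs <;> simp_all [Pi.single_apply, Fin.ext_iff]

lemma al_cr_self (i : Fin n) : al i (cr i) = 2 := by
  rw [al_apply]; simp only [cr_apply, Fin.ext_iff]; grind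

lemma Bapply (i j : Fin n) : CoxeterMatrix.B n i j = if i = j then 1
      else (if (i : ℕ) = n - 1 ∧ (j : ℕ) = n - 2 ∨ (j : ℕ) = n - 1 ∧ (i : ℕ) = n - 2 then 4
        else (if (j : ℕ) + 1 = i ∨ (i : ℕ) + 1 = j then 3 else 2)) := rfl

lemma al_cr2 {i j : Fin n} (h : CoxeterMatrix.B n i j = 2) : al i (cr j) = 0 := by
  rw [al_apply]; simp only [cr_apply, Fin.ext_iff]; rw [Bapply] at h; grind

lemma al_cr3 {i j : Fin n} (h : CoxeterMatrix.B n i j = 3) : al i (cr j) = -1 := by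
  rw [al_apply]; simp only [cr_apply, Fin.ext_iff]; rw [Bapply] at h; grind

lemma al_cr4 {i j : Fin n} (h : CoxeterMatrix.B n i j = 4) :
    (al i (cr j) = -1 ∧ al j (cr i) = -2) ∨ (al i (cr j) = -2 ∧ al j (cr i) = -1) := by
  rw [al_apply, al_apply]; simp only [cr_apply, Fin.ext_iff]; rw [Bapply] at h; grind

lemma Bcases (i j : Fin n) : i = j ∨ CoxeterMatrix.B n i j = 2 ∨ CoxeterMatrix.B n i j = 3 ∨
    CoxeterMatrix.B n i j = 4 := by
  rw [Bapply]; grind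

lemma al_rf (i j : Fin n) (v : Fin n → ℤ) : al i (rf j v) = al i v - al j v * al i (cr j) := by
  rw [rf_apply, map_sub, map_smul, smul_eq_mul]

lemma rf_rf (i : Fin n) (v : Fin n → ℤ) : rf i (rf i v) = v := by
  rw [rf_apply, al_rf, rf_apply, al_cr_self]; module

lemma rf_braid2 {i j : Fin n} (h : CoxeterMatrix.B n i j = 2) (v : Fin n → ℤ) :
    rf i (rf j v) = rf j (rf i v) := by
  have h' := h; rw [CoxeterMatrix.symmetric] at h'
  simp only [rf_apply, al_rf, map_sub, map_smul, al_cr2 h, al_cr2 h', smul_eq_mul]; module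

lemma rf_braid3 {i j : Fin n} (h : CoxeterMatrix.B n i j = 3) (v : Fin n → ℤ) :
    rf i (rf j (rf i v)) = rf j (rf i (rf j v)) := by
  have h' := h; rw [CoxeterMatrix.symmetric] at h'
  simp only [rf_apply, map_sub, map_smul, al_cr3 h, al_cr3 h', al_cr_self, smul_eq_mul]; module

lemma rf_braid4 {i j : Fin n} (h : CoxeterMatrix.B n i j = 4) (v : Fin n → ℤ) :
    rf i (rf j (rf i (rf j v))) = rf j (rf i (rf j (rf i v))) := by
  rcases al_cr4 h with ⟨h1, h2⟩ | ⟨h1, h2⟩ <;>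
  simp only [rf_apply, map_sub, map_smul, h1, h2, al_cr_self, smul_eq_mul] <;> module

lemma rf_liftable : (CoxeterMatrix.B n).IsLiftable (rf (n := n)) := by
  intro i j
  refine LinearMap.ext fun v => ?_
  rcases Bcases i j with h | h | h | h
  · subst h; simp [rf_rf]
  · simp only [h, pow_succ, pow_zero, one_mul, Module.End.mul_apply, Module.End.one_apply]
    rw [rf_braid2 h, rf_rf, rf_rf]
  · simp only [h, pow_succ, pow_zero, one_mul, Module.End.mul_apply, Module.End.one_apply]
    rw [rf_braid3 h, rf_rf, rf_rf, rf_rf]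
  · simp only [h, pow_succ, pow_zero, one_mul, Module.End.mul_apply, Module.End.one_apply]
    rw [rf_braid4 h, rf_rf, rf_rf, rf_rf, rf_rf]

/-- strictly dominant regular vector -/
def rho (n : ℕ) : Fin n → ℤ := fun a => n - a

def msr (v : Fin n → ℤ) : ℕ := (dotProduct (v - rho n) (v - rho n)).toNat

lemma msr_lt {i : Fin n} {v : Fin n → ℤ} (h : al i v < 0) : msr (rf i v) < msr v := by
  have key : dotProduct (rf i v - rho n) (rf i v - rho n)
      < dotProduct (v - rho n) (v - rho n) := by
    have e : rf i v - rho n = (v - rho n) - al i v • cr i := by rw [rf_apply]; module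
    have e2 : dotProduct (cr i) (v - rho n) = (if (i : ℕ) + 1 < n then 1 else 2) * (al i v - 1) := by
      rw [al_apply]; unfold cr
      split_ifs with h1
      · simp [sub_dotProduct, rho]
        try ring
      · have : (n : ℤ) = i + 1 := by have := i.2; omega
        simp [rho, this]
        try ring
    have e3 : dotProduct (cr i) (cr i) = (if (i : ℕ) + 1 < n then 2 else 4) := by
      unfold cr
      split_ifs with h1
      · simp [sub_dotProduct, Pi.single_apply, Fin.ext_iff]
      · simp
    rw [e]
    generalize v - rho n = z at *
    have : dotProduct (z - al i v • cr i) (z - al i v • cr i) = dotProduct z z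
        - 2 * al i v * dotProduct (cr i) z + al i v ^ 2 * dotProduct (cr i) (cr i) := by
      simp only [sub_dotProduct, dotProduct_sub, smul_dotProduct, dotProduct_smul, smul_eq_mul,
        dotProduct_comm z (cr i)]; ring
    rw [this, e2, e3]
    split_ifs <;> nlinarith
  have h0 : 0 ≤ dotProduct (rf i v - rho n) (rf i v - rho n) :=
    Finset.sum_nonneg fun a _ => mul_self_nonneg _
  unfold msr; omega

section conf
variable {Y : Type*} (g : Fin n → Y → Y) (y0 : Y)

open Classical in
noncomputable def Psi (v : Fin n → ℤ) : Y :=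
  if h : ∃ i, al i v < 0 then g h.choose (Psi (rf h.choose v)) else y0
termination_by msr v
decreasing_by exact msr_lt h.choose_spec

lemma Psi_dom {v : Fin n → ℤ} (h : ∀ i, 0 ≤ al i v) : Psi g y0 v = y0 := by
  rw [Psi, dif_neg]; push Not; exact h

lemma Psi_des
    (h2 : ∀ i j, CoxeterMatrix.B n i j = 2 → ∀ y, g i (g j y) = g j (g i y))
    (h3 : ∀ i j, CoxeterMatrix.B n i j = 3 → ∀ y, g i (g j (g i y)) = g j (g i (g j y)))
    (h4 : ∀ i j, CoxeterMatrix.B n i j = 4 → ∀ y,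
      g i (g j (g i (g j y))) = g j (g i (g j (g i y)))) :
    ∀ (N : ℕ) (v : Fin n → ℤ), msr v < N → ∀ i, al i v < 0 → Psi g y0 v = g i (Psi g y0 (rf i v)) := by
  intro N
  induction N with
  | zero => intro v hv; omega
  | succ N ih =>
  intro v hv i hi
  have hex : ∃ i, al i v < 0 := ⟨i, hi⟩
  rw [Psi, dif_pos hex]
  have hj := hex.choose_spec
  generalize hex.choose = j at hj
  have mi := msr_lt hi
  have mj := msr_lt hj
  have step : ∀ (z : Fin n → ℤ) (k : Fin n), msr z < N → al k z < 0 →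
      Psi g y0 z = g k (Psi g y0 (rf k z)) ∧ msr (rf k z) < N := by
    intro z k hz hk
    exact ⟨ih z hz k hk, (msr_lt hk).trans hz⟩
  rcases Bcases i j with h | h | h | h
  · rw [h]
  · have h' := h; rw [CoxeterMatrix.symmetric] at h'
    obtain ⟨a1, _⟩ := step (rf i v) j (by omega) (by simp only [al_rf, al_cr2 h']; omega)
    obtain ⟨b1, _⟩ := step (rf j v) i (by omega) (by simp only [al_rf, al_cr2 h]; omega)
    rw [a1, b1, h2 i j h, rf_braid2 h]
  · have h' := h; rw [CoxeterMatrix.symmetric] at h'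
    obtain ⟨a1, a⟩ := step (rf i v) j (by omega) (by simp only [al_rf, al_cr3 h']; omega)
    obtain ⟨a2, _⟩ := step (rf j (rf i v)) i a
      (by simp only [al_rf, al_cr3 h, al_cr3 h', al_cr_self]; omega)
    obtain ⟨b1, b⟩ := step (rf j v) i (by omega) (by simp only [al_rf, al_cr3 h]; omega)
    obtain ⟨b2, _⟩ := step (rf i (rf j v)) j b
      (by simp only [al_rf, al_cr3 h, al_cr3 h', al_cr_self]; omega)
    rw [a1, a2, b1, b2, h3 i j h, rf_braid3 h]
  · rcases al_cr4 h with ⟨c1, c2⟩ | ⟨c1, c2⟩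
    all_goals
      obtain ⟨a1, a⟩ := step (rf i v) j (by omega) (by simp only [al_rf, c1, c2]; omega)
      obtain ⟨a2, a'⟩ := step (rf j (rf i v)) i a
        (by simp only [al_rf, c1, c2, al_cr_self]; omega)
      obtain ⟨a3, _⟩ := step (rf i (rf j (rf i v))) j a'
        (by simp only [al_rf, c1, c2, al_cr_self]; omega)
      obtain ⟨b1, b⟩ := step (rf j v) i (by omega) (by simp only [al_rf, c1, c2]; omega)
      obtain ⟨b2, b'⟩ := step (rf i (rf j v)) j b
        (by simp only [al_rf, c1, c2, al_cr_self]; omega)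
      obtain ⟨b3, _⟩ := step (rf j (rf i (rf j v))) i b'
        (by simp only [al_rf, c1, c2, al_cr_self]; omega)
      rw [a1, a2, a3, b1, b2, b3, h4 i j h, rf_braid4 h]
end conf

lemma rf_form (i : Fin n) : ∃ σ : Fin n → Fin n, Function.Injective σ ∧
    ∀ v a, rf i v a = v (σ a) ∨ rf i v a = - v (σ a) := by
  by_cases h : (i : ℕ) + 1 < n
  · refine ⟨Equiv.swap i ⟨i + 1, h⟩, Equiv.injective _, fun v a => Or.inl ?_⟩
    rw [rf_apply]
    simp only [Pi.sub_apply, Pi.smul_apply, cr_apply, al_apply, Equiv.swap_apply_def, h, if_true,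
      dif_pos, smul_eq_mul]
    split_ifs with h1 h2 h3 h3
    · subst h1; ring
    · have : a = ⟨i + 1, h⟩ := Fin.ext h2
      rw [this]; ring
    · exact absurd (Fin.ext h2) h3
    · exact absurd (by rw [h3]) h2
    · ring
  · refine ⟨id, Function.injective_id, fun v a => ?_⟩
    rw [rf_apply]
    simp only [Pi.sub_apply, Pi.smul_apply, cr_apply, al_apply, h, if_false, dif_neg,
      not_false_eq_true, smul_eq_mul, id]
    split_ifs with h1
    · subst h1; right; ring
    · left; ring

def InBox (k : ℤ) (v : Fin n → ℤ) : Prop := ∀ a, -k ≤ v a ∧ v a ≤ k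

lemma InBox.rf {k : ℤ} {v : Fin n → ℤ} (i : Fin n) (h : InBox k v) : InBox k (rf i v) := by
  obtain ⟨σ, -, hσ⟩ := rf_form i
  intro a
  have := h (σ a)
  rcases hσ v a with e | e <;> rw [e] <;> constructor <;> omega

lemma InBox.al {k : ℤ} {v : Fin n → ℤ} (i : Fin n) (h : InBox k v) :
    -(2 * k) ≤ al i v ∧ al i v ≤ 2 * k := by
  rw [al_apply]
  have := h i
  split_ifs with h1
  · have := h ⟨i + 1, h1⟩; omega
  · omega

def Gen (v : Fin n → ℤ) : Prop :=
  (∀ a, v a ≠ 0) ∧ ∀ a b, a ≠ b → v a ≠ v b ∧ v a ≠ - v b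

lemma Gen.rf {v : Fin n → ℤ} (i : Fin n) (h : Gen v) : Gen (rf i v) := by
  obtain ⟨σ, hi, hσ⟩ := rf_form i
  constructor
  · intro a
    have := h.1 (σ a)
    rcases hσ v a with e | e <;> rw [e] <;> omega
  · intro a b hab
    have := h.2 (σ a) (σ b) (hi.ne hab)
    rcases hσ v a with e | e <;> rcases hσ v b with e' | e' <;> rw [e, e'] <;> omega

lemma Gen.al {v : Fin n → ℤ} (i : Fin n) (h : Gen v) : al i v ≠ 0 := by
  rw [al_apply]
  split_ifs with h1
  · have := (h.2 i ⟨i + 1, h1⟩ (by simp [Fin.ext_iff])).1; omega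
  · exact h.1 i

lemma Gen_rho : Gen (rho n) := by
  refine ⟨fun a => ?_, fun a b hab => ?_⟩
  · have := a.2; simp only [rho]; omega
  · have := a.2; have := b.2; simp only [rho]
    have : (a : ℕ) ≠ b := fun h => hab (Fin.ext h)
    omega

lemma rho_SD (i : Fin n) : 0 < al i (rho n) := by
  have := i.2
  rw [al_apply]; simp only [rho]; split_ifs <;> push_cast <;> omega

lemma rho_box : InBox (n : ℤ) (rho n) := by
  intro a; have := a.2; simp only [rho]; omega

section grp
variable {W : Type*} [Group W] (cs : CoxeterSystem (CoxeterMatrix.B n) W)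

noncomputable def phi : W →* Module.End ℤ (Fin n → ℤ) := cs.lift ⟨rf, rf_liftable⟩

noncomputable def act (v : Fin n → ℤ) (w : W) : Fin n → ℤ := phi cs w⁻¹ v

lemma act_simple (v : Fin n → ℤ) (w : W) (i : Fin n) :
    act cs v (w * cs.simple i) = rf i (act cs v w) := by
  simp [act, phi, CoxeterSystem.lift_apply_simple]

lemma act_one (v : Fin n → ℤ) : act cs v 1 = v := by simp [act]

lemma act_mul (v : Fin n → ℤ) (w w' : W) : act cs v (w * w') = act cs (act cs v w) w' := by
  simp [act]

lemma act_add (v v' : Fin n → ℤ) (c : ℤ) (w : W) :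
    act cs (c • v + v') w = c • act cs v w + act cs v' w := by
  rw [act, map_add, map_smul]; rfl

lemma act_ind (P : (Fin n → ℤ) → Prop) (hP : ∀ i v, P v → P (rf i v)) {v : Fin n → ℤ}
    (hv : P v) (w : W) : P (act cs v w) := by
  induction w using cs.simple_induction_right with
  | one => rwa [act_one]
  | mul_simple_right w i ih => rw [act_simple]; exact hP _ _ ih

noncomputable def Ps (v : Fin n → ℤ) : W × ℕ :=
  Psi (fun i (y : W × ℕ) => (y.1 * cs.simple i, y.2 + 1)) (1, 0) v

lemma Ps_des {i : Fin n} {v : Fin n → ℤ} (h : al i v < 0) :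
    Ps cs v = ((Ps cs (rf i v)).1 * cs.simple i, (Ps cs (rf i v)).2 + 1) := by
  unfold Ps
  refine Psi_des _ _ ?_ ?_ ?_ _ v (Nat.lt_succ_self _) i h
  all_goals
    intro i j h y
    have h' := h; rw [CoxeterMatrix.symmetric] at h'
    have b := cs.wordProd_braidWord_eq i j
    simp only [CoxeterSystem.braidWord, h, h', CoxeterSystem.alternatingWord,
      CoxeterSystem.wordProd, List.concat_eq_append, List.nil_append, List.cons_append,
      List.map_cons, List.map_nil, List.prod_cons, List.prod_nil, mul_one] at b
    simp only [mul_assoc, b]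

lemma Ps_dom {v : Fin n → ℤ} (h : ∀ i, 0 ≤ al i v) : Ps cs v = (1, 0) := Psi_dom _ _ h

lemma Ps_asc {i : Fin n} {v : Fin n → ℤ} (h : 0 < al i v) :
    Ps cs (rf i v) = ((Ps cs v).1 * cs.simple i, (Ps cs v).2 + 1) := by
  rw [Ps_des cs (i := i) (by rw [al_rf, al_cr_self]; omega), rf_rf]

lemma Ps_len : ∀ (N : ℕ) (v : Fin n → ℤ), msr v < N → cs.length (Ps cs v).1 ≤ (Ps cs v).2 := by
  intro N
  induction N with
  | zero => intro v hv; omega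
  | succ N ih =>
    intro v hv
    by_cases hd : ∃ i, al i v < 0
    · obtain ⟨i, hi⟩ := hd
      rw [Ps_des cs hi]
      have := ih (rf i v) (by have := msr_lt hi; omega)
      have h2 := cs.length_mul_le (Ps cs (rf i v)).1 (cs.simple i)
      rw [cs.length_simple] at h2
      exact h2.trans (by simpa using this)
    · push Not at hd
      rw [Ps_dom cs hd]; simp

lemma Ps_act {z : Fin n → ℤ} (hz : ∀ i, 0 < al i z) (hr : ∀ w i, al i (act cs z w) ≠ 0) (w : W) :
    (Ps cs (act cs z w)).1 = w := by
  induction w using cs.simple_induction_right with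
  | one => rw [act_one, Ps_dom cs fun i => (hz i).le]
  | mul_simple_right w i ih =>
    rw [act_simple]
    rcases lt_or_gt_of_ne (hr w i) with h | h
    · rw [Ps_des cs h] at ih
      simp only at ih
      rw [← cs.simple_mul_simple_cancel_right (w := (Ps cs (rf i (act cs z w))).1) i, ih]
    · rw [Ps_asc cs h, ih]

lemma Ps_le {z : Fin n → ℤ} (hz : ∀ i, 0 < al i z) (hr : ∀ w i, al i (act cs z w) ≠ 0)
    (ω : List (Fin n)) : (Ps cs (act cs z (cs.wordProd ω))).2 ≤ ω.length := by
  induction ω using List.reverseRecOn with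
  | nil => rw [cs.wordProd_nil, act_one, Ps_dom cs fun i => (hz i).le]; simp
  | append_singleton ω i ih =>
    rw [cs.wordProd_append, cs.wordProd_singleton, act_simple]
    simp only [List.length_append, List.length_singleton]
    rcases lt_or_gt_of_ne (hr (cs.wordProd ω) i) with h | h
    · rw [Ps_des cs h] at ih
      simp only at ih
      omega
    · rw [Ps_asc cs h]; simpa using ih

lemma length_eq {z : Fin n → ℤ} (hz : ∀ i, 0 < al i z) (hr : ∀ w i, al i (act cs z w) ≠ 0)
    (w : W) : cs.length w = (Ps cs (act cs z w)).2 := by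
  apply le_antisymm
  · have := Ps_len cs _ (act cs z w) (Nat.lt_succ_self _)
    rwa [Ps_act cs hz hr] at this
  · obtain ⟨ω, h1, h2⟩ := cs.exists_isReduced w
    have := Ps_le cs hz hr ω
    rw [← h2] at this
    rw [h2, h1.eq, ← h2]; exact this

lemma rho_reg (w : W) (i : Fin n) : al i (act cs (rho n) w) ≠ 0 :=
  (act_ind cs Gen (fun i v h => h.rf i) Gen_rho w).al i

lemma des_iff (w : W) (i : Fin n) :
    cs.length (w * cs.simple i) < cs.length w ↔ al i (act cs (rho n) w) < 0 := by
  rw [length_eq cs rho_SD (rho_reg cs), length_eq cs rho_SD (rho_reg cs), act_simple]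
  rcases lt_or_gt_of_ne (rho_reg cs w i) with h | h
  · rw [Ps_des cs h]; simp [h]
  · rw [Ps_asc cs h]; simp only; constructor <;> intro _ <;> omega

lemma existsUnique_w [Finite W] {z : Fin n → ℤ} (hr : ∀ (w : W) i, al i (act cs z w) ≠ 0) :
    ∃! w : W, ∀ i, 0 < al i (act cs z w) := by
  obtain ⟨w, hw⟩ := Finite.exists_min fun w : W => msr (act cs z w)
  have h1 : ∀ i, 0 < al i (act cs z w) := by
    intro i
    by_contra hi
    have := msr_lt (lt_of_le_of_ne (not_lt.1 hi) (hr w i))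
    have h2 := hw (w * cs.simple i)
    rw [act_simple] at h2
    omega
  refine ⟨w, h1, fun w' h' => ?_⟩
  have := Ps_act cs h1 (fun g i => by rw [← act_mul]; exact hr _ i) (w⁻¹ * w')
  rw [← act_mul, mul_inv_cancel_left, Ps_dom cs fun i => (h' i).le] at this
  exact (inv_mul_eq_one.1 this.symm).symm

lemma reg_shift (y : Fin n → ℤ) (w : W) (i : Fin n) :
    al i (act cs ((2 * n + 1 : ℤ) • y + rho n) w) ≠ 0 := by
  rw [act_add, map_add, map_smul, smul_eq_mul]
  have h1 := rho_reg cs w i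
  have h2 := (act_ind cs (InBox (n : ℤ)) (fun i v h => h.rf i) rho_box w).al i
  intro h
  have : (2 * n + 1 : ℤ) ∣ al i (act cs (rho n) w) :=
    ⟨- al i (act cs y w), by linarith⟩
  exact h1 (Int.eq_zero_of_abs_lt_dvd this (by rw [abs_lt]; constructor <;> omega))

lemma SD_iff (u : Fin n → ℤ) (w : W) (i : Fin n) :
    0 < al i ((2 * n + 1 : ℤ) • u + act cs (rho n) w) ↔
      ((if cs.length (w * cs.simple i) < cs.length w then 1 else 0 : ℕ) : ℤ) ≤ al i u := by
  rw [map_add, map_smul, smul_eq_mul]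
  have h1 := rho_reg cs w i
  have h2 := (act_ind cs (InBox (n : ℤ)) (fun i v h => h.rf i) rho_box w).al i
  simp only [des_iff]
  have hn : (0 : ℤ) ≤ n := by positivity
  split_ifs with h
  · push_cast
    constructor
    · intro h3; by_contra h4
      have : al i u ≤ 0 := by omega
      nlinarith
    · intro h3; nlinarith
  · push_cast
    constructor
    · intro h3; by_contra h4
      have : al i u ≤ -1 := by omega
      nlinarith
    · intro h3
      have : 0 < al i (act cs (rho n) w) := by omega
      nlinarith

end grp

noncomputable def Box (n k : ℕ) : Finset (Fin n → ℤ) := Fintype.piFinset fun _ => Finset.Icc (-k : ℤ) k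

lemma mem_Box {k : ℕ} {v : Fin n → ℤ} : v ∈ Box n k ↔ InBox (k : ℤ) v := by
  simp [Box, InBox]

lemma card_Box (k : ℕ) : (Box n k).card = (2 * k + 1) ^ n := by
  simp only [Box, Fintype.card_piFinset, Int.card_Icc, Finset.prod_const, Finset.card_univ,
    Fintype.card_fin]
  congr 1; omega

lemma tele (u : Fin n → ℤ) : ∀ (m : ℕ) (a : Fin n), n - a = m → ∑ b ∈ Finset.Ici a, al b u = u a := by
  intro m
  induction m with
  | zero => intro a h; have := a.2; omega
  | succ m ih =>
    intro a h
    have hI : Finset.Ici a = insert a (Finset.Ioi a) := by simp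
    rw [hI, Finset.sum_insert (by simp), al_apply]
    split_ifs with h1
    · have : Finset.Ioi a = Finset.Ici (⟨a + 1, h1⟩ : Fin n) := by
        ext b; simp only [Finset.mem_Ioi, Finset.mem_Ici, Fin.lt_def, Fin.le_def]; omega
      rw [this, ih ⟨a + 1, h1⟩ (by simp only; omega)]; ring
    · have : Finset.Ioi a = ∅ := by
        ext b; have := b.2; simp only [Finset.mem_Ioi, Fin.lt_def, Finset.notMem_empty, iff_false]; omega
      rw [this]; simp

lemma al_tail (q : Fin n → ℤ) (i : Fin n) : al i (fun a => ∑ b ∈ Finset.Ici a, q b) = q i := by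
  have hI : Finset.Ici i = insert i (Finset.Ioi i) := by simp
  rw [al_apply]
  split_ifs with h1
  · have : Finset.Ioi i = Finset.Ici (⟨i + 1, h1⟩ : Fin n) := by
      ext b; simp only [Finset.mem_Ioi, Finset.mem_Ici, Fin.lt_def, Fin.le_def]; omega
    rw [hI, Finset.sum_insert (by simp), this]; ring
  · have : Finset.Ioi i = ∅ := by
      ext b; have := b.2; simp only [Finset.mem_Ioi, Fin.lt_def, Finset.notMem_empty, iff_false]; omega
    rw [hI, Finset.sum_insert (by simp), this]; simp

lemma sum_al (hn : 0 < n) (u : Fin n → ℤ) : ∑ b, al b u = u ⟨0, hn⟩ := by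
  rw [← tele u _ ⟨0, hn⟩ rfl]
  congr 1
  ext b; simp [Fin.le_def]

open Classical in
lemma cnt (hn : 0 < n) (k : ℕ) (δ : Fin n → ℕ) (D : ℕ) (hD : ∑ i, δ i = D) :
    ((Box n k).filter fun u => ∀ i, (δ i : ℤ) ≤ al i u).card =
      if D ≤ k then (k - D + n).choose n else 0 := by
  have hD' : ∑ i, (δ i : ℤ) = D := by rw [← hD]; push_cast; rfl
  split_ifs with hk
  · have hc := Finset.card_finsuppAntidiag_nat_eq_choose (s := (Finset.univ : Finset (Option (Fin n)))) (k - D)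
    have : (k - D + n).choose n = (Finset.card (Finset.univ : Finset (Option (Fin n))) + (k - D) - 1).choose (k - D) := by
      rw [Finset.card_univ, Fintype.card_option, Fintype.card_fin,
        show n + 1 + (k - D) - 1 = (k - D) + n by omega]
      exact (Nat.choose_symm_add).symm
    rw [this, ← hc]
    refine Finset.card_nbij'
      (fun u => Finsupp.equivFunOnFinite.symm fun o => o.elim (k - ∑ b, al b u).toNat
        fun i => (al i u - δ i).toNat)
      (fun p a => ∑ b ∈ Finset.Ici a, ((p (some b) : ℤ) + δ b)) ?_ ?_ ?_ ?_
    · intro u hu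
      simp only [Finset.coe_filter, Set.mem_ofPred_eq, mem_Box] at hu
      simp only [Finset.mem_coe, Finset.mem_finsuppAntidiag, Fintype.sum_option,
        Finsupp.equivFunOnFinite_symm_apply_apply, Option.elim]
      refine ⟨?_, by simp⟩
      zify
      have h1 : ((k - ∑ b, al b u).toNat : ℤ) = k - ∑ b, al b u := by
        apply Int.toNat_of_nonneg
        rw [sum_al hn]; have := (hu.1 ⟨0, hn⟩).2; omega
      have h2 : ∀ i, ((al i u - δ i).toNat : ℤ) = al i u - δ i := fun i =>
        Int.toNat_of_nonneg (by have := hu.2 i; omega)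
      rw [h1, Finset.sum_congr rfl fun i _ => h2 i, Finset.sum_sub_distrib, hD']
      push_cast [hk]; ring
    · intro p hp
      simp only [Finset.mem_coe, Finset.mem_finsuppAntidiag, Fintype.sum_option] at hp
      have hp1 := hp.1
      zify [hk] at hp1
      simp only [Finset.coe_filter, Set.mem_ofPred_eq, mem_Box, al_tail]
      refine ⟨fun a => ?_, fun i => by omega⟩
      have h0 : 0 ≤ ∑ b ∈ Finset.Ici a, ((p (some b) : ℤ) + δ b) :=
        Finset.sum_nonneg fun _ _ => by positivity
      have h1 : ∑ b ∈ Finset.Ici a, ((p (some b) : ℤ) + δ b) ≤ ∑ b, ((p (some b) : ℤ) + δ b) :=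
        Finset.sum_le_sum_of_subset_of_nonneg (Finset.subset_univ _) fun _ _ _ => by positivity
      rw [Finset.sum_add_distrib (s := Finset.univ), hD'] at h1
      have h2 : (0 : ℤ) ≤ (p none : ℤ) := by positivity
      change -(k : ℤ) ≤ ∑ b ∈ Finset.Ici a, ((p (some b) : ℤ) + δ b) ∧
        ∑ b ∈ Finset.Ici a, ((p (some b) : ℤ) + δ b) ≤ k
      constructor <;> linarith
    · intro u hu
      simp only [Finset.coe_filter, Set.mem_ofPred_eq, mem_Box] at hu
      funext a
      rw [← tele u _ a rfl]
      refine Finset.sum_congr rfl fun b _ => ?_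
      have := hu.2 b
      simp only [Finsupp.equivFunOnFinite_symm_apply_apply, Option.elim]
      omega
    · intro p hp
      simp only [Finset.mem_coe, Finset.mem_finsuppAntidiag, Fintype.sum_option] at hp
      have hp1 := hp.1
      zify [hk] at hp1
      ext o
      simp only [Finsupp.equivFunOnFinite_symm_apply_apply, al_tail]
      cases o with
      | none =>
        simp only [Option.elim, Finset.sum_add_distrib, hD']
        omega
      | some i => simp only [Option.elim]; omega
  · rw [Finset.card_eq_zero, Finset.filter_eq_empty_iff]
    intro u hu h
    have h1 := (mem_Box.1 hu ⟨0, hn⟩).2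
    rw [← sum_al hn u] at h1
    have : ∑ i, (δ i : ℤ) ≤ ∑ i, al i u := Finset.sum_le_sum fun i _ => h i
    omega

open Classical in
lemma main_count (hn : 0 < n) {W : Type*} [Group W] [Fintype W]
    (cs : CoxeterSystem (CoxeterMatrix.B n) W) (k : ℕ) :
    ∑ w : W, (k + n - coxNumDescents cs w).choose n = (2 * k + 1) ^ n := by
  have h1 : ∀ w : W, (k + n - coxNumDescents cs w).choose n =
      ((Box n k).filter fun y => ∀ i, 0 < al i (act cs ((2 * n + 1 : ℤ) • y + rho n) w)).card := by
    intro w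
    have hd : coxNumDescents cs w ≤ n := by
      unfold coxNumDescents
      exact (Finset.card_le_univ _).trans (by simp)
    have e : (k + n - coxNumDescents cs w).choose n =
        if coxNumDescents cs w ≤ k then (k - coxNumDescents cs w + n).choose n else 0 := by
      split_ifs with h
      · congr 1; omega
      · exact Nat.choose_eq_zero_of_lt (by omega)
    rw [e, ← cnt hn k (fun i => if cs.length (w * cs.simple i) < cs.length w then 1 else 0) _
      (by rw [coxNumDescents, Finset.card_filter])]
    simp only [← SD_iff cs]
    refine Finset.card_nbij' (fun u => act cs u w⁻¹) (fun y => act cs y w) ?_ ?_ ?_ ?_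
    · intro u hu
      simp only [Finset.coe_filter, Set.mem_ofPred_eq, mem_Box] at hu ⊢
      refine ⟨act_ind cs _ (fun i v h => h.rf i) hu.1 _, ?_⟩
      rw [act_add, ← act_mul, inv_mul_cancel, act_one]
      exact hu.2
    · intro y hy
      simp only [Finset.coe_filter, Set.mem_ofPred_eq, mem_Box] at hy ⊢
      refine ⟨act_ind cs _ (fun i v h => h.rf i) hy.1 _, ?_⟩
      rw [← act_add]
      exact hy.2
    · intro u _; simp only; rw [← act_mul, inv_mul_cancel, act_one]
    · intro u _; simp only; rw [← act_mul, mul_inv_cancel, act_one]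
  simp only [h1, Finset.card_filter]
  rw [Finset.sum_comm, ← card_Box (n := n) k, Finset.card_eq_sum_ones]
  refine Finset.sum_congr rfl fun y _ => ?_
  rw [← Finset.card_filter, Finset.card_eq_one]
  obtain ⟨w, hw, hu⟩ := existsUnique_w cs (reg_shift cs y)
  refine ⟨w, ?_⟩
  ext w'
  simp only [Finset.mem_filter, Finset.mem_univ, true_and, Finset.mem_singleton]
  exact ⟨hu w', fun h => h ▸ hw⟩

lemma genBinom_nat (N n : ℕ) : genBinom N n = N.choose n := by
  have : ∏ i ∈ Finset.range n, ((N : ℝ) - i) = N.descFactorial n := by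
    induction n with
    | zero => simp
    | succ n ih =>
      rw [Finset.prod_range_succ, ih, Nat.descFactorial_succ]
      rcases le_or_gt n N with h | h
      · push_cast [h]; ring
      · rw [Nat.descFactorial_of_lt h]; simp
  rw [genBinom, this, Nat.descFactorial_eq_factorial_mul_choose]
  push_cast
  field_simp

open Polynomial in
lemma genBinom_poly (n : ℕ) (c : ℝ) :
    ∃ p : ℝ[X], ∀ x : ℝ, p.eval x = genBinom ((x - 1) / 2 + n - c) n := by
  refine ⟨C ((n.factorial : ℝ)⁻¹) * ∏ i ∈ Finset.range n,
    (C (1 / 2) * (X - 1) + C ((n : ℝ) - c - i)), fun x => ?_⟩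
  rw [genBinom, eval_mul, eval_prod, eval_C, inv_mul_eq_div]
  congr 1
  apply Finset.prod_congr rfl
  intro i _
  simp only [eval_add, eval_mul, eval_sub, eval_C, eval_X, eval_one]
  ring

open Polynomial in
lemma main_B (hn : 0 < n) {W : Type*} [Group W] [Fintype W]
    (cs : CoxeterSystem (CoxeterMatrix.B n) W) (x : ℝ) :
    ∑ w : W, genBinom ((x - 1) / 2 + n - coxNumDescents cs w) n = x ^ n := by
  choose p hp using fun w : W => genBinom_poly n (coxNumDescents cs w)
  have key : ∑ w, p w = (X ^ n : ℝ[X]) := by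
    apply Polynomial.eq_of_infinite_eval_eq
    refine Set.infinite_of_injective_forall_mem (f := fun k : ℕ => (2 * k + 1 : ℝ)) ?_ ?_
    · intro a b h
      simpa using h
    · intro k
      simp only [Set.mem_ofPred_eq, eval_finsetSum, eval_pow, eval_X, hp]
      have := main_count hn cs k
      have h2 : ((∑ w : W, (k + n - coxNumDescents cs w).choose n : ℕ) : ℝ) = (2 * k + 1) ^ n := by
        rw [this]; push_cast; rfl
      rw [← h2]
      push_cast
      refine Finset.sum_congr rfl fun w _ => ?_
      rw [← genBinom_nat]
      have hd : coxNumDescents cs w ≤ n := by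
        unfold coxNumDescents
        exact (Finset.card_le_univ _).trans (by simp)
      congr 1
      rw [Nat.cast_sub (by omega)]
      push_cast; ring
  have := congrArg (eval x) key
  simpa only [eval_finsetSum, eval_pow, eval_X, hp] using this

end RB

/-- The type `B` riffle shuffle measure is a (signed) probability measure:
`∑_{w ∈ W} C((x-1)/2 + n - d(w), n) = xⁿ` for `W` a finite Coxeter group
of type `Bₙ`. -/
theorem sum_riffle_measure_type_B (n : ℕ) (hn : 2 ≤ n) {W : Type*} [Group W]
    [Fintype W] (cs : CoxeterSystem (CoxeterMatrix.Bₙ n) W) (x : ℝ) :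
    ∑ w : W, genBinom ((x - 1) / 2 + n - coxNumDescents cs w) n = x ^ n := by
  exact RB.main_B (by omega) cs x
end

section
/- Let n ≥ 2, let (W,S) be a Coxeter system whose Coxeter matrix is of type B_n, and suppose W is finite. Then for all nonzero real numbers x and y and every w ∈ W, ∑_{(u,v) ∈ W × W, uv = w} [C((x−1)/2 + n − d(u), n)/x^n] · [C((y−1)/2 + n − d(v), n)/y^n] = C((xy−1)/2 + n − d(w), n)/(xy)^n. -/
theorem rmB_ascent {n : ℕ} {W : Type*} [Group W] {M : CoxeterMatrix (Fin n)}
    (cs : CoxeterSystem M W) {R : Type*} [AddCommGroup R] (Q : R → Prop)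
    (Qadd : ∀ a b, Q a → Q b → Q (a + b))
    (c : W → Fin n → R)
    (hM : ∀ i j, i ≠ j → M i j = 2 ∨ M i j = 3 ∨ M i j = 4)
    (h1 : ∀ w i, c (w * cs.simple i) i = - c w i)
    (h2 : ∀ w i j, M i j = 2 → c (w * cs.simple i) j = c w j)
    (h3 : ∀ w i j, M i j = 3 → c (w * cs.simple i) j = c w j + c w i)
    (h4 : ∀ i j, M i j = 4 →
      ((∀ w, c (w * cs.simple i) j = c w j + c w i) ∧
        (∀ w, c (w * cs.simple j) i = c w i + (c w j + c w j))) ∨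
      ((∀ w, c (w * cs.simple i) j = c w j + (c w i + c w i)) ∧
        (∀ w, c (w * cs.simple j) i = c w i + c w j)))
    (hQ : ∀ i, Q (c 1 i)) :
    ∀ N w i, cs.length w = N → ¬ cs.IsRightDescent w i → Q (c w i) := by
  intro N
  induction N using Nat.strong_induction_on with
  | _ N ih =>
  intro w s hN hs
  by_cases hw : w = 1
  · subst hw; exact hQ s
  obtain ⟨t, ht⟩ := cs.exists_rightDescent_of_ne_one hw
  have hst : t ≠ s := by rintro rfl; exact hs ht
  have step : ∀ (w : W) t, cs.IsRightDescent w t → ∃ w1, w = w1 * cs.simple t ∧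
      ¬ cs.IsRightDescent w1 t ∧ cs.length w1 + 1 = cs.length w := by
    intro w t h
    refine ⟨w * cs.simple t, by simp, ?_, cs.isRightDescent_iff.1 h⟩
    exact (cs.isRightDescent_iff_not_isRightDescent_mul).1 h
  have up := cs.not_isRightDescent_iff.1 hs
  have bl : ∀ (w : W) t, cs.length (w * cs.simple t) ≤ cs.length w + 1 := by
    intro w t
    have := cs.length_mul_le w (cs.simple t)
    simpa using this
  have pw := cs.simple_mul_simple_pow t s
  have inv := cs.inv_simple
  obtain ⟨w1, rfl, d1, l1⟩ := step w t ht
  have q1 := ih _ (by omega) w1 t rfl d1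
  rcases hM t s hst with m | m | m
  · -- m = 2
    rw [h2 _ _ _ m]
    refine ih _ (by omega) w1 s rfl ?_
    intro d
    obtain ⟨w2, rfl, d2, l2⟩ := step w1 s d
    rw [m] at pw
    have e : w2 * cs.simple s * cs.simple t * cs.simple s = w2 * cs.simple t := by
      have : cs.simple s * cs.simple t * cs.simple s = cs.simple t := by
        have h := pw
        simp only [pow_succ, pow_zero, one_mul] at h
        have h' := congrArg (fun z => cs.simple t * z) h
        simpa [mul_assoc] using h'
      rw [mul_assoc, mul_assoc, ← mul_assoc (cs.simple s), this]
    rw [e] at up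
    have := bl w2 t
    omega
  · rw [h3 _ _ _ m]
    by_cases d : cs.IsRightDescent w1 s
    swap
    · exact Qadd _ _ (ih _ (by omega) w1 s rfl d) q1
    obtain ⟨w2, rfl, d2, l2⟩ := step w1 s d
    have m' : M s t = 3 := by rw [M.symmetric]; exact m
    rw [h1, h3 _ _ _ m']
    have : -c w2 s + (c w2 t + c w2 s) = c w2 t := by abel
    rw [this]
    refine ih _ (by omega) w2 t rfl ?_
    intro d
    obtain ⟨w3, rfl, d3, l3⟩ := step w2 t d
    rw [m] at pw
    have e : w3 * cs.simple t * cs.simple s * cs.simple t * cs.simple s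
        = w3 * cs.simple s * cs.simple t := by
      have h := pw
      simp only [pow_succ, pow_zero, one_mul] at h
      have h' := congrArg (fun z => w3 * z * cs.simple s * cs.simple t) h
      simpa [mul_assoc] using h'
    rw [e] at up
    have := bl w3 s
    have := bl (w3 * cs.simple s) t
    omega
  · have fin : ∀ w3, cs.length w3 + 3 = cs.length (w1 * cs.simple t) →
        w1 * cs.simple t = w3 * cs.simple t * cs.simple s * cs.simple t → 
          ¬ cs.IsRightDescent w3 s := by
      intro w3 l3 e3 d
      obtain ⟨w4, rfl, d4, l4⟩ := step w3 s d
      rw [m] at pw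
      have e : w1 * cs.simple t * cs.simple s
          = w4 * cs.simple t * cs.simple s * cs.simple t := by
        rw [e3]
        have h := pw
        simp only [pow_succ, pow_zero, one_mul] at h
        have h'' := congrArg (fun z => w4 * cs.simple t * cs.simple s * cs.simple t * z) h
        simpa [mul_assoc] using h''
      rw [e] at up
      have := bl w4 t
      have := bl (w4 * cs.simple t) s
      have := bl (w4 * cs.simple t * cs.simple s) t
      omega
    rcases h4 _ _ m with ⟨k1, k2⟩ | ⟨k1, k2⟩
    · rw [k1]
      by_cases d : cs.IsRightDescent w1 s
      swap
      · exact Qadd _ _ (ih _ (by omega) w1 s rfl d) q1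
      obtain ⟨w2, rfl, d2, l2⟩ := step w1 s d
      have q2 := ih _ (by omega) w2 s rfl d2
      rw [h1, k2]
      have : -c w2 s + (c w2 t + (c w2 s + c w2 s)) = c w2 s + c w2 t := by abel
      rw [this]
      by_cases d : cs.IsRightDescent w2 t
      swap
      · exact Qadd _ _ q2 (ih _ (by omega) w2 t rfl d)
      obtain ⟨w3, rfl, d3, l3⟩ := step w2 t d
      rw [h1, k1]
      have : c w3 s + c w3 t + - c w3 t = c w3 s := by abel
      rw [this]
      exact ih _ (by omega) w3 s rfl (fin w3 (by omega) rfl)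
    · rw [k1]
      by_cases d : cs.IsRightDescent w1 s
      swap
      · exact Qadd _ _ (ih _ (by omega) w1 s rfl d) (Qadd _ _ q1 q1)
      obtain ⟨w2, rfl, d2, l2⟩ := step w1 s d
      have q2 := ih _ (by omega) w2 s rfl d2
      rw [h1, k2]
      have : -c w2 s + (c w2 t + c w2 s + (c w2 t + c w2 s)) = c w2 s + (c w2 t + c w2 t) := by
        abel
      rw [this]
      by_cases d : cs.IsRightDescent w2 t
      swap
      · have := (ih _ (by omega) w2 t rfl d)
        exact Qadd _ _ q2 (Qadd _ _ this this)
      obtain ⟨w3, rfl, d3, l3⟩ := step w2 t d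
      rw [h1, k1]
      have : c w3 s + (c w3 t + c w3 t) + (- c w3 t + - c w3 t) = c w3 s := by abel
      rw [this]
      exact ih _ (by omega) w3 s rfl (fin w3 (by omega) rfl)

/-- coroot pairing with the simple roots of type B -/
def rmBc {n : ℕ} (i : Fin n) : (Fin n → ℤ) →ₗ[ℤ] ℤ :=
  LinearMap.proj i - (if h : i.val + 1 < n then LinearMap.proj ⟨i.val + 1, h⟩ else 0)

/-- reflection vectors -/
def rmBa {n : ℕ} (i : Fin n) : Fin n → ℤ := fun k =>
  if k = i then (if i.val + 1 = n then 2 else 1) else if k.val = i.val + 1 then -1 else 0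

/-- simple reflections -/
def rmBs {n : ℕ} (i : Fin n) : Module.End ℤ (Fin n → ℤ) :=
  LinearMap.id - (rmBc i).smulRight (rmBa i)

theorem rmBs_apply {n : ℕ} (i : Fin n) (f : Fin n → ℤ) : rmBs i f = f - rmBc i f • rmBa i := by
  simp [rmBs]

theorem rmBc_apply {n : ℕ} (i : Fin n) (f : Fin n → ℤ) :
    rmBc i f = f i - (if h : i.val + 1 < n then f ⟨i.val + 1, h⟩ else 0) := by
  unfold rmBc
  split_ifs <;> simp

theorem rmBc_self {n : ℕ} (i : Fin n) : rmBc i (rmBa i) = 2 := by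
  rw [rmBc_apply]
  unfold rmBa
  have hi := i.2
  by_cases h : i.val + 1 = n
  · simp [h]
  · have h' : i.val + 1 < n := by omega
    simp [h, h', Fin.ext_iff]

theorem rmBM {n : ℕ} (i j : Fin n) (h : i ≠ j) : 
    (CoxeterMatrix.Bₙ n i j = 2 ∧ rmBc j (rmBa i) = 0 ∧ rmBc i (rmBa j) = 0) ∨
    (CoxeterMatrix.Bₙ n i j = 3 ∧ rmBc j (rmBa i) = -1 ∧ rmBc i (rmBa j) = -1) ∨
    (CoxeterMatrix.Bₙ n i j = 4 ∧ 
      ((rmBc j (rmBa i) = -1 ∧ rmBc i (rmBa j) = -2) ∨ 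
       (rmBc j (rmBa i) = -2 ∧ rmBc i (rmBa j) = -1))) := by
  obtain ⟨i, hi⟩ := i
  obtain ⟨j, hj⟩ := j
  simp only [ne_eq, Fin.mk.injEq] at h
  simp only [rmBc_apply, CoxeterMatrix.Bₙ, CoxeterMatrix.B, rmBa, Matrix.of_apply, Fin.mk.injEq]
  rcases Nat.lt_trichotomy i j with h' | h' | h'
  · by_cases e : j = i + 1
    · subst e
      by_cases e' : i + 1 + 1 = n
      · subst e'; simp; try omega
      · have : i + 1 + 1 < n := by omega
        have e1 : ¬ (i + 1 = n) := by omega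
        have e2 : ¬ (i + 1 = n - 1) := by omega
        have e3 : ¬ (i = n - 1) := by omega
        simp [*]; try omega
    · have e2 : ¬ (j = n - 1 ∧ i = n - 2) := by omega
      have e3 : ¬ (i = n - 1 ∧ j = n - 2) := by omega
      have e4 : ¬ (j + 1 = i) := by omega
      have e5 : ¬ (i + 1 = j) := by omega
      have e6 : ¬ (j = i) := by omega
      have e7 : i + 1 < n := by omega
      have e8 : ¬ (j  + 1 = i + 1) := by omega
      have e9 : ¬ (i + 1 = j + 1) := by omega
      simp [*]; try omega
  · omega
  · by_cases e : i = j + 1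
    · subst e
      by_cases e' : j + 1 + 1 = n
      · subst e'; simp; try omega
      · have : j + 1 + 1 < n := by omega
        have e1 : ¬ (j + 1 = n) := by omega
        have e2 : ¬ (j + 1 = n - 1) := by omega
        have e3 : ¬ (j = n - 1) := by omega
        simp [*]; try omega
    · have e2 : ¬ (j = n - 1 ∧ i = n - 2) := by omega
      have e3 : ¬ (i = n - 1 ∧ j = n - 2) := by omega
      have e4 : ¬ (j + 1 = i) := by omega
      have e5 : ¬ (i + 1 = j) := by omega
      have e6 : ¬ (j = i) := by omega
      have e7 : j + 1 < n := by omega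
      have e8 : ¬ (j  + 1 = i + 1) := by omega
      have e9 : ¬ (i + 1 = j + 1) := by omega
      simp [*]; try omega

theorem rmB_liftable {n : ℕ} : (CoxeterMatrix.Bₙ n).IsLiftable (rmBs (n := n)) := by
  intro i j
  by_cases h : i = j
  · subst h
    apply LinearMap.ext
    intro f
    simp only [CoxeterMatrix.diagonal, pow_one, Module.End.mul_apply, Module.End.one_apply,
      rmBs_apply, map_sub, map_smul, rmBc_self, smul_eq_mul]
    module
  · have hi := rmBc_self i
    have hj := rmBc_self j
    rcases rmBM i j h with ⟨m, a, b⟩ | ⟨m, a, b⟩ | ⟨m, ⟨a, b⟩ | ⟨a, b⟩⟩ <;>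
    · rw [m]
      apply LinearMap.ext
      intro f
      simp only [pow_succ, pow_zero, one_mul, Module.End.mul_apply, Module.End.one_apply,
        rmBs_apply, map_sub, map_smul, hi, hj, a, b, smul_eq_mul]
      module

section rep
variable {n : ℕ} {W : Type*} [Group W] (cs : CoxeterSystem (CoxeterMatrix.Bₙ n) W)

/-- the reflection representation -/
def rmBφ : W →* Module.End ℤ (Fin n → ℤ) := cs.lift ⟨rmBs, rmB_liftable⟩

/-- right action -/
def rmBP (w : W) : Module.End ℤ (Fin n → ℤ) := rmBφ cs w⁻¹

theorem rmBP_one : rmBP cs 1 = 1 := by simp [rmBP]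

theorem rmBP_mul (u v : W) (f : Fin n → ℤ) : rmBP cs (u * v) f = rmBP cs v (rmBP cs u f) := by
  simp [rmBP, Module.End.mul_apply]

theorem rmBP_simple (i : Fin n) : rmBP cs (cs.simple i) = rmBs i := by
  simp only [rmBP, cs.inv_simple, rmBφ, CoxeterSystem.lift_apply_simple]

theorem rmBc_P_simple (w : W) (i j : Fin n) (f : Fin n → ℤ) :
    rmBc j (rmBP cs (w * cs.simple i) f) =
      rmBc j (rmBP cs w f) - rmBc i (rmBP cs w f) * rmBc j (rmBa i) := by
  rw [rmBP_mul, rmBP_simple, rmBs_apply, map_sub, map_smul, smul_eq_mul]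

/-- the staircase vector -/
def rmBδ (n : ℕ) : Fin n → ℤ := fun k => n - k.val

theorem rmBc_δ (i : Fin n) : rmBc i (rmBδ n) = 1 := by
  rw [rmBc_apply]
  have := i.2
  unfold rmBδ
  split_ifs
  · push_cast; ring
  · have : i.val + 1 = n := by omega
    have : (n : ℤ) = i.val + 1 := by exact_mod_cast this.symm
    omega

theorem rmB_desc {R : Type*} [AddCommGroup R] (Q : R → Prop)
    (Qadd : ∀ a b, Q a → Q b → Q (a + b)) (Q0 : ¬ Q 0)
    (c' : W → Fin n → R)
    (hc : ∀ w i j, c' (w * cs.simple i) j = c' w j - rmBc j (rmBa i) • c' w i)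
    (hQ : ∀ i, Q (c' 1 i)) (w : W) (i : Fin n) :
    ((¬ cs.IsRightDescent w i) ↔ Q (c' w i)) ∧ (cs.IsRightDescent w i ↔ Q (- c' w i)) := by
  have A : ∀ w i, ¬ cs.IsRightDescent w i → Q (c' w i) := by
    intro w i
    refine rmB_ascent cs Q Qadd c' ?_ ?_ ?_ ?_ ?_ hQ _ w i rfl
    · intro i j h
      rcases rmBM i j h with h | h | h <;> simp [h.1]
    · intro w i
      rw [hc, rmBc_self]; module
    · intro w i j h
      have hne : i ≠ j := by rintro rfl; simp at h
      rcases rmBM i j hne with h' | h' | h' <;> simp_all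
    · intro w i j h
      have hne : i ≠ j := by rintro rfl; simp at h
      rcases rmBM i j hne with h' | h' | h' <;> simp_all
    · intro i j h
      have hne : i ≠ j := by rintro rfl; simp at h
      rcases rmBM i j hne with h' | h' | ⟨-, ⟨a, b⟩ | ⟨a, b⟩⟩
      · omega
      · omega
      · left
        constructor <;> intro w <;> rw [hc] <;> simp only [a, b] <;> module
      · right
        constructor <;> intro w <;> rw [hc] <;> simp only [a, b] <;> module
  have B : cs.IsRightDescent w i → Q (- c' w i) := by
    intro d
    have := A _ _ (cs.isRightDescent_iff_not_isRightDescent_mul.1 d)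
    rw [hc, rmBc_self] at this
    convert this using 1
    module
  have C : ∀ x, Q x → Q (-x) → False := by
    intro x h h'
    apply Q0
    simpa using Qadd _ _ h h'
  by_cases d : cs.IsRightDescent w i
  · have := B d
    have := C (c' w i)
    tauto
  · have := A _ _ d
    have := C (c' w i)
    tauto

theorem rmB_descδ (w : W) (i : Fin n) :
    ((¬ cs.IsRightDescent w i) ↔ 0 < rmBc i (rmBP cs w (rmBδ n))) ∧
      (cs.IsRightDescent w i ↔ 0 < - rmBc i (rmBP cs w (rmBδ n))) := by
  refine rmB_desc cs (fun x : ℤ => 0 < x) (fun a b h h' => add_pos h h') (by simp)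
    (fun w i => rmBc i (rmBP cs w (rmBδ n))) ?_ ?_ w i
  · intro w i j
    simp only [rmBc_P_simple, smul_eq_mul]; ring
  · intro i
    simp [rmBP_one, rmBc_δ]

/-- `v` lies in the half-open chamber attached to `w` -/
def rmBGood (w : W) (v : Fin n → ℤ) : Prop :=
  ∀ i, 0 < rmBc i v ∨ (rmBc i v = 0 ∧ ¬ cs.IsRightDescent w i)

theorem rmB_key (u w : W) (b : Fin n → ℤ) (h : rmBGood cs u (rmBP cs u b)) (i : Fin n) :
    (0 < rmBc i (rmBP cs w b) ∨ (rmBc i (rmBP cs w b) = 0 ∧ ¬ cs.IsRightDescent w i)) ↔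
      ¬ cs.IsRightDescent (u⁻¹ * w) i := by
  have := (rmB_desc cs (fun x : ℤ × ℤ => 0 < x.1 ∨ (x.1 = 0 ∧ 0 < x.2)) ?_ (by simp)
    (fun g i => (rmBc i (rmBP cs (u * g) b), rmBc i (rmBP cs (u * g) (rmBδ n)))) ?_ ?_
      (u⁻¹ * w) i).1
  · rw [this, (rmB_descδ cs w i).1]
    simp
  · rintro ⟨a, a'⟩ ⟨b, b'⟩ h h'
    simp only [Prod.mk_add_mk] at *
    omega
  · intro w i j
    ext
    · simp only [← mul_assoc, rmBc_P_simple, Prod.smul_mk, Prod.fst_sub, smul_eq_mul]; ring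
    · simp only [← mul_assoc, rmBc_P_simple, Prod.smul_mk, Prod.snd_sub, smul_eq_mul]; ring
  · intro i
    simp only [mul_one, ← (rmB_descδ cs u i).1]
    exact h i

theorem rmB_unique (u u' : W) (b : Fin n → ℤ) (h : rmBGood cs u (rmBP cs u b))
    (h' : rmBGood cs u' (rmBP cs u' b)) : u = u' := by
  have : u⁻¹ * u' = 1 := by
    by_contra hne
    obtain ⟨i, hi⟩ := cs.exists_rightDescent_of_ne_one hne
    exact (rmB_key cs u u' b h i).1 (h' i) hi
  rwa [inv_mul_eq_one] at this

theorem rmB_exists [Finite W] (b : Fin n → ℤ) : ∃ u, rmBGood cs u (rmBP cs u b) := by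
  let H : (Fin n → ℤ) → ℤ := fun z => ∑ k, z k * rmBδ n k
  have Hs : ∀ i z, ∃ a > 0, H (rmBs i z) = H z - rmBc i z * a := by
    intro i z
    refine ⟨H (rmBa i), ?_, ?_⟩
    · have hi := i.2
      by_cases h : i.val + 1 < n
      · have : H (rmBa i) = ∑ k ∈ {i, ⟨i.val + 1, h⟩}, rmBa i k * rmBδ n k := by
          symm
          apply Finset.sum_subset (Finset.subset_univ _)
          intro k _ hk
          simp only [Finset.mem_insert, Finset.mem_singleton, not_or, Fin.ext_iff] at hk
          simp [rmBa, hk, Fin.ext_iff]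
        rw [this, Finset.sum_pair (by simp [Fin.ext_iff])]
        have h' : i.val + 1 ≠ n := by omega
        simp [rmBa, rmBδ, Fin.ext_iff, h']
      · have : H (rmBa i) = ∑ k ∈ {i}, rmBa i k * rmBδ n k := by
          symm
          apply Finset.sum_subset (Finset.subset_univ _)
          intro k _ hk
          have hk2 := k.2
          have h' : k.val ≠ i.val + 1 := by omega
          simp only [Finset.mem_singleton, Fin.ext_iff] at hk
          simp [rmBa, hk, Fin.ext_iff, h']
        rw [this, Finset.sum_singleton]
        have h' : i.val + 1 = n := by omega
        simp [rmBa, rmBδ, h']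
    · simp only [H, rmBs_apply, Pi.sub_apply, Pi.smul_apply, smul_eq_mul, sub_mul,
        Finset.sum_sub_distrib, Finset.mul_sum, mul_assoc]
  obtain ⟨u, hu⟩ := Finite.exists_max
    (fun u : W => toLex (H (rmBP cs u b), H (rmBP cs u (rmBδ n))))
  refine ⟨u, fun i => ?_⟩
  have := hu (u * cs.simple i)
  simp only [Prod.Lex.toLex_le_toLex, rmBP_mul, rmBP_simple] at this
  obtain ⟨a, ha, e⟩ := Hs i (rmBP cs u b)
  obtain ⟨a', ha', e'⟩ := Hs i (rmBP cs u (rmBδ n))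
  rw [e, e'] at this
  have t1 := (rmB_descδ cs u i).1
  have t2 := (rmB_descδ cs u i).2
  rcases lt_trichotomy (rmBc i (rmBP cs u b)) 0 with h | h | h
  · exfalso
    have : rmBc i (rmBP cs u b) * a < 0 := mul_neg_of_neg_of_pos h ha
    omega
  · right
    refine ⟨h, fun d => ?_⟩
    have h2 := t2.1 d
    have : rmBc i (rmBP cs u (rmBδ n)) * a' < 0 := mul_neg_of_neg_of_pos (by omega) ha'
    simp only [h] at *
    omega
  · exact Or.inl h

theorem rmB_box (w : W) : ∀ (K : ℤ) (f : Fin n → ℤ), (∀ k, |f k| ≤ K) →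
    ∀ k, |rmBP cs w f k| ≤ K := by
  refine cs.simple_induction_right (p := fun w => ∀ (K : ℤ) (f : Fin n → ℤ), (∀ k, |f k| ≤ K) →
    ∀ k, |rmBP cs w f k| ≤ K) w ?_ ?_
  · intro K f h; simpa [rmBP_one] using h
  · intro w i ih K f h k
    rw [rmBP_mul, rmBP_simple, rmBs_apply]
    have ih := ih K f h
    generalize rmBP cs w f = g at ih
    simp only [rmBc_apply, rmBa, Pi.sub_apply, Pi.smul_apply, smul_eq_mul]
    have hi := i.2
    by_cases hk : k = i
    · subst hk
      by_cases h1 : k.val + 1 < n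
      · have : k.val + 1 ≠ n := by omega
        simpa [h1, this] using ih ⟨k.val + 1, h1⟩
      · have : k.val + 1 = n := by omega
        have e : g k - g k * 2 = - g k := by ring
        simpa [this, e] using ih k
    · by_cases h1 : k.val = i.val + 1
      · have h2 : i.val + 1 < n := by have := k.2; omega
        have h3 : (⟨i.val + 1, h2⟩ : Fin n) = k := Fin.ext h1.symm
        rw [if_neg hk, if_pos h1, dif_pos h2, h3]
        have e : g k - (g i - g k) * -1 = g i := by ring
        rw [e]
        exact ih i
      · simpa [hk, h1] using ih k

open Classical in
/-- lattice points of the half-open chamber in the box -/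
noncomputable def rmBZ (K : ℕ) (w : W) : Finset (Fin n → ℤ) :=
  (Fintype.piFinset (fun _ => Finset.Icc (-(K : ℤ)) K)).filter (rmBGood cs w)

theorem rmB_mem_Z (K : ℕ) (w : W) (v : Fin n → ℤ) :
    v ∈ rmBZ cs K w ↔ (∀ k, |v k| ≤ K) ∧ rmBGood cs w v := by
  simp [rmBZ, abs_le]

theorem rmB_c_bound (i : Fin n) (l : ℤ) (f : Fin n → ℤ) (h : ∀ k, |f k| ≤ l) : 
    |rmBc i f| ≤ 2 * l := by
  rw [rmBc_apply]
  have h0 := h i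
  split_ifs with h'
  · have h1 := h ⟨_, h'⟩
    rw [abs_le] at *
    omega
  · rw [abs_le] at *
    omega

theorem rmB_conv_nat [Fintype W] [DecidableEq W] (k l : ℕ) (w : W) :
    ∑ p ∈ Finset.univ.filter (fun p : W × W => p.1 * p.2 = w),
      (rmBZ cs l p.1).card * (rmBZ cs k p.2).card = (rmBZ cs (2 * k * l + k + l) w).card := by
  have hP : ∀ w f, rmBP cs w (rmBP cs w⁻¹ f) = f := by
    intro w f
    rw [← rmBP_mul]; simp [rmBP_one]
  have hP' : ∀ w f, rmBP cs w⁻¹ (rmBP cs w f) = f := by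
    intro w f
    rw [← rmBP_mul]; simp [rmBP_one]
  have cadd : ∀ i (a b : Fin n → ℤ), rmBc i ((2 * (l : ℤ) + 1) • a + b) =
      (2 * (l : ℤ) + 1) * rmBc i a + rmBc i b := by
    intro i a b; rw [map_add, map_smul, smul_eq_mul]
  have e : ∀ p : W × W, (rmBZ cs l p.1).card * (rmBZ cs k p.2).card =
      (rmBZ cs l p.1 ×ˢ rmBZ cs k p.2).card := fun p => (Finset.card_product _ _).symm
  simp only [e]
  rw [← Finset.card_sigma]
  -- uniqueness of balanced division
  have divu : ∀ a b a' b' : ℤ, |b| ≤ l → |b'| ≤ l →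
      (2 * (l : ℤ) + 1) * a + b = (2 * (l : ℤ) + 1) * a' + b' → a = a' ∧ b = b' := by
    intro a b a' b' hb hb' h
    rw [abs_le] at hb hb'
    have : a = a' := by
      rcases lt_trichotomy a a' with h' | h' | h'
      · nlinarith
      · exact h'
      · nlinarith
    subst this
    exact ⟨rfl, by linarith⟩
  refine Finset.card_bij
    (fun (q : (_ : W × W) × ((Fin n → ℤ) × (Fin n → ℤ))) _ =>
      (2 * (l : ℤ) + 1) • q.2.2 + rmBP cs q.1.2 q.2.1) ?_ ?_ ?_
  · rintro ⟨⟨u, g⟩, v, a⟩ hq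
    simp only [Finset.mem_sigma, Finset.mem_filter, Finset.mem_univ, true_and,
      Finset.mem_product, rmB_mem_Z] at hq ⊢
    obtain ⟨rfl, ⟨hv, gv⟩, ha, ga⟩ := hq
    have hb := rmB_box cs g l v hv
    refine ⟨fun j => ?_, fun i => ?_⟩
    · have h1 := ha j
      have h2 := hb j
      simp only [Pi.add_apply, Pi.smul_apply, smul_eq_mul]
      rw [abs_le] at *
      push_cast
      constructor <;> nlinarith
    · rw [cadd]
      have h1 := rmB_c_bound i l _ hb
      rw [abs_le] at h1
      rcases ga i with h | ⟨h, d⟩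
      · left; nlinarith
      · have := (rmB_key cs u (u * g) (rmBP cs u⁻¹ v) (by rwa [hP]) i).2 (by simpa using d)
        rw [rmBP_mul, hP] at this
        rw [h, mul_zero, zero_add]
        exact this
  · rintro ⟨⟨u, g⟩, v, a⟩ hq ⟨⟨u', g'⟩, v', a'⟩ hq' heq
    simp only [Finset.mem_sigma, Finset.mem_filter, Finset.mem_univ, true_and,
      Finset.mem_product, rmB_mem_Z] at hq hq' heq
    obtain ⟨rfl, ⟨hv, gv⟩, ha, ga⟩ := hq
    obtain ⟨hw, ⟨hv', gv'⟩, ha', ga'⟩ := hq'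
    have hb := rmB_box cs g l v hv
    have hb' := rmB_box cs g' l v' hv'
    have key : ∀ j, a j = a' j ∧ rmBP cs g v j = rmBP cs g' v' j := by
      intro j
      have := congrFun heq j
      simp only [Pi.add_apply, Pi.smul_apply, smul_eq_mul] at this
      exact divu _ _ _ _ (hb j) (hb' j) this
    have ea : a = a' := funext fun j => (key j).1
    have eb : rmBP cs g v = rmBP cs g' v' := funext fun j => (key j).2
    have e1 : rmBP cs (u * g)⁻¹ (rmBP cs g v) = rmBP cs u⁻¹ v := by
      rw [mul_inv_rev, rmBP_mul, hP']
    have e2 : rmBP cs (u * g)⁻¹ (rmBP cs g' v') = rmBP cs u'⁻¹ v' := by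
      rw [← hw, mul_inv_rev, rmBP_mul, hP']
    have e3 : rmBP cs u⁻¹ v = rmBP cs u'⁻¹ v' := by rw [← e1, ← e2, eb]
    have eu : u = u' := rmB_unique cs u u' (rmBP cs u⁻¹ v) (by rwa [hP]) (by rwa [e3, hP])
    subst eu
    have eg : g' = g := mul_left_cancel hw
    subst eg
    have ev : v = v' := by
      have := congrArg (rmBP cs g'⁻¹) eb
      rwa [hP', hP'] at this
    subst ev
    subst ea
    rfl
  · intro z hz
    rw [rmB_mem_Z] at hz
    obtain ⟨hz, gz⟩ := hz
    let a : Fin n → ℤ := fun j => (z j + l) / (2 * (l : ℤ) + 1)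
    let b : Fin n → ℤ := fun j => (z j + l) % (2 * (l : ℤ) + 1) - l
    have zab : z = (2 * (l : ℤ) + 1) • a + b := by
      funext j
      simp only [a, b, Pi.add_apply, Pi.smul_apply, smul_eq_mul]
      have := Int.mul_ediv_add_emod (z j + l) (2 * (l : ℤ) + 1)
      linarith
    have hb : ∀ j, |b j| ≤ l := by
      intro j
      have h1 := Int.emod_nonneg (z j + l) (show (2 * (l : ℤ) + 1) ≠ 0 by omega)
      have h2 := Int.emod_lt_of_pos (z j + l) (show 0 < (2 * (l : ℤ) + 1) by omega)
      rw [abs_le]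
      simp only [b]
      omega
    have ha : ∀ j, |a j| ≤ k := by
      intro j
      have h1 := hz j
      have h2 := hb j
      have h3 := congrFun zab j
      simp only [Pi.add_apply, Pi.smul_apply, smul_eq_mul] at h3
      rw [abs_le] at *
      push_cast at h1
      constructor
      · by_contra hc
        push Not at hc
        have : a j + 1 ≤ -k := hc
        nlinarith
      · by_contra hc
        push Not at hc
        have : (k : ℤ) + 1 ≤ a j := hc
        nlinarith
    obtain ⟨u, hu⟩ := rmB_exists cs (rmBP cs w⁻¹ b)
    refine ⟨⟨(u, u⁻¹ * w), rmBP cs u (rmBP cs w⁻¹ b), a⟩, ?_, ?_⟩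
    · simp only [Finset.mem_sigma, Finset.mem_filter, Finset.mem_univ, true_and,
        Finset.mem_product, rmB_mem_Z]
      refine ⟨by simp, ⟨rmB_box cs _ _ _ (rmB_box cs _ _ _ hb), hu⟩, ha, ?_⟩
      intro i
      have h1 := rmB_c_bound i l _ hb
      rw [abs_le] at h1
      have h2 := gz i
      rw [zab, cadd] at h2
      rcases lt_trichotomy (rmBc i a) 0 with h | h | h
      · exfalso
        have : (2 * (l : ℤ) + 1) * rmBc i a + rmBc i b < 0 := by nlinarith
        omega
      · right
        refine ⟨h, ?_⟩
        rw [← rmB_key cs u w _ hu i, hP]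
        simpa [h] using h2
      · exact Or.inl h
    · simp only
      rw [zab, ← rmBP_mul]
      simp [hP]

end rep

section count
variable {n : ℕ}

theorem rmB_sumIci (x : Fin n → ℤ) (k : Fin n) :
    ∑ i ∈ Finset.Ici k, x i =
      x k + (if h : k.val + 1 < n then ∑ i ∈ Finset.Ici (⟨k.val + 1, h⟩ : Fin n), x i else 0) := by
  split_ifs with h
  · have : Finset.Ici k = insert k (Finset.Ici (⟨k.val + 1, h⟩ : Fin n)) := by
      ext j
      simp only [Finset.mem_Ici, Finset.mem_insert, Fin.le_def, Fin.ext_iff]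
      omega
    rw [this, Finset.sum_insert (by simp [Fin.le_def])]
  · have : Finset.Ici k = {k} := by
      ext j
      have := j.2
      simp only [Finset.mem_Ici, Finset.mem_singleton, Fin.le_def, Fin.ext_iff]
      omega
    rw [this]; simp

theorem rmBc_sumIci (x : Fin n → ℤ) (i : Fin n) :
    rmBc i (fun k => ∑ i ∈ Finset.Ici k, x i) = x i := by
  rw [rmBc_apply, rmB_sumIci]
  ring

theorem rmB_sum_c (z : Fin n → ℤ) : ∀ (m : ℕ) (k : Fin n), n - k.val = m →
    ∑ i ∈ Finset.Ici k, rmBc i z = z k := by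
  intro m
  induction m with
  | zero => intro k hk; have := k.2; omega
  | succ m ih =>
    intro k hk
    rw [rmB_sumIci, rmBc_apply]
    split_ifs with h
    · rw [ih ⟨k.val + 1, h⟩ (by simp only; omega)]; ring
    · ring

theorem rmB_sum_c_univ (hn : 0 < n) (z : Fin n → ℤ) : ∑ i, rmBc i z = z ⟨0, hn⟩ := by
  rw [← rmB_sum_c z _ ⟨0, hn⟩ rfl]
  congr 1
  ext j
  simp [Fin.le_def]

theorem rmB_count {W : Type*} [Group W] (cs : CoxeterSystem (CoxeterMatrix.Bₙ n) W)
    (hn : 0 < n) (K : ℕ) (w : W) :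
    (rmBZ cs K w).card = (K + n - coxNumDescents cs w).choose n := by
  classical
  set d := coxNumDescents cs w with hd
  let t : Fin n → ℤ := fun i => if cs.IsRightDescent w i then 1 else 0
  have ht0 : ∀ i, 0 ≤ t i := by intro i; simp only [t]; split_ifs <;> simp
  have ht : ∑ i, t i = d := by
    rw [hd, coxNumDescents, Finset.card_filter]
    push_cast
    refine Finset.sum_congr rfl fun i _ => ?_
    by_cases h : cs.length (w * cs.simple i) < cs.length w
    · simp [t, h, CoxeterSystem.IsRightDescent]
    · simp [t, h, CoxeterSystem.IsRightDescent]
  have good : ∀ z, rmBGood cs w z ↔ ∀ i, t i ≤ rmBc i z := by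
    intro z
    unfold rmBGood
    refine forall_congr' fun i => ?_
    simp only [t]
    split_ifs with h
    · simp only [h, not_true_eq_false, and_false, or_false]; omega
    · simp only [h, not_false_eq_true, and_true]; omega
  have dn : d ≤ n := by
    rw [hd, coxNumDescents]
    exact (Finset.card_le_univ _).trans (by simp)
  by_cases hK : d ≤ K
  swap
  · rw [Nat.choose_eq_zero_of_lt (by omega), Finset.card_eq_zero, Finset.eq_empty_iff_forall_notMem]
    intro z hz
    rw [rmB_mem_Z, good] at hz
    have h1 := Finset.sum_le_sum (fun i (_ : i ∈ Finset.univ) => hz.2 i)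
    rw [ht, rmB_sum_c_univ hn] at h1
    have h2 := hz.1 ⟨0, hn⟩
    rw [abs_le] at h2
    omega
  have e : (K + n - d).choose n =
      ((Finset.univ : Finset (Option (Fin n))).finsuppAntidiag (K - d)).card := by
    rw [Finset.card_finsuppAntidiag_nat_eq_choose]
    simp only [Finset.card_univ, Fintype.card_option, Fintype.card_fin]
    have e1 : n + 1 + (K - d) - 1 = K + n - d := by omega
    rw [e1]
    apply Nat.choose_symm_of_eq_add
    omega
  rw [e]
  symm
  refine Finset.card_bij
    (fun (e : Option (Fin n) →₀ ℕ) _ => fun k => ∑ i ∈ Finset.Ici k, ((e (some i) : ℤ) + t i))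
    ?_ ?_ ?_
  · intro e he
    rw [Finset.mem_finsuppAntidiag, Fintype.sum_option] at he
    rw [rmB_mem_Z, good]
    refine ⟨fun k => ?_, fun i => ?_⟩
    · have hnn : ∀ i, 0 ≤ (e (some i) : ℤ) + t i := fun i => add_nonneg (by simp) (ht0 i)
      rw [abs_of_nonneg (Finset.sum_nonneg fun i _ => hnn i)]
      refine (Finset.sum_le_univ_sum_of_nonneg hnn).trans ?_
      rw [Finset.sum_add_distrib, ht]
      have := he.1
      zify [hK] at this
      linarith [Int.natCast_nonneg (e none)]
    · rw [rmBc_sumIci]; simp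
  · intro e he e' he' h
    rw [Finset.mem_finsuppAntidiag, Fintype.sum_option] at he he'
    have h1 : ∀ i, e (some i) = e' (some i) := by
      intro i
      have := congrArg (rmBc i) h
      simp only [rmBc_sumIci] at this
      omega
    ext o
    cases o with
    | none =>
      have h2 := he.1
      have h3 := he'.1
      simp only [h1] at h2
      omega
    | some i => exact h1 i
  · intro z hz
    rw [rmB_mem_Z, good] at hz
    obtain ⟨hz, gz⟩ := hz
    have h0 := rmB_sum_c_univ hn z
    have h2 := hz ⟨0, hn⟩
    rw [abs_le] at h2
    have hx : ∀ i, ((rmBc i z - t i).toNat : ℤ) = rmBc i z - t i := by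
      intro i; have := gz i; omega
    have hs : ((∑ i, (rmBc i z - t i).toNat : ℕ) : ℤ) = z ⟨0, hn⟩ - d := by
      push_cast [hx]
      have : ∑ i, (((rmBc i z - t i).toNat : ℕ) : ℤ) = ∑ i, (rmBc i z - t i) :=
        Finset.sum_congr rfl fun i _ => hx i
      first
        | rw [this, Finset.sum_sub_distrib, ht, h0]
        | rw [Finset.sum_sub_distrib, ht, h0]
    refine ⟨Finsupp.equivFunOnFinite.symm (fun o => o.elim
      (K - d - ∑ i, (rmBc i z - t i).toNat) (fun i => (rmBc i z - t i).toNat)), ?_, ?_⟩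
    · rw [Finset.mem_finsuppAntidiag, Fintype.sum_option]
      refine ⟨?_, Finset.subset_univ _⟩
      simp only [Finsupp.equivFunOnFinite_symm_apply_apply, Option.elim]
      omega
    · funext k
      simp only [Finsupp.equivFunOnFinite_symm_apply_apply, Option.elim, hx]
      simp only [sub_add_cancel]
      exact rmB_sum_c z _ k rfl

theorem rmB_genBinom_nat (m n : ℕ) : genBinom (m : ℝ) n = (m.choose n : ℝ) := by
  unfold genBinom
  rw [Nat.cast_choose_eq_descPochhammer_div]
  congr 1
  rw [descPochhammer_eval_eq_prod_range]

theorem rmB_genBinom_poly (a b : ℝ) (n : ℕ) :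
    ∃ p : Polynomial ℝ, ∀ x, p.eval x = genBinom (a * x + b) n := by
  refine ⟨(∏ i ∈ Finset.range n, (Polynomial.C a * Polynomial.X + Polynomial.C (b - i))) *
    Polynomial.C ((n.factorial : ℝ)⁻¹), fun x => ?_⟩
  simp only [genBinom, Polynomial.eval_mul, Polynomial.eval_prod, Polynomial.eval_add,
    Polynomial.eval_C, Polynomial.eval_X, div_eq_mul_inv]
  congr 1
  apply Finset.prod_congr rfl
  intros; ring

theorem rmB_poly_ext (p q : Polynomial ℝ)
    (h : ∀ k : ℕ, p.eval (2 * (k : ℝ) + 1) = q.eval (2 * (k : ℝ) + 1)) : p = q := by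
  apply Polynomial.eq_of_infinite_eval_eq
  refine Set.infinite_of_injective_forall_mem (f := fun k : ℕ => 2 * (k : ℝ) + 1) ?_ h
  intro a b hab
  simpa using hab

end count

theorem rmB_real {n : ℕ} (hn : 2 ≤ n) {W : Type*}
    [Group W] [Fintype W] [DecidableEq W]
    (cs : CoxeterSystem (CoxeterMatrix.Bₙ n) W) (x y : ℝ) (w : W) :
    ∑ p ∈ Finset.univ.filter (fun p : W × W => p.1 * p.2 = w),
      genBinom ((x - 1) / 2 + n - coxNumDescents cs p.1) n *
        genBinom ((y - 1) / 2 + n - coxNumDescents cs p.2) n =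
      genBinom ((x * y - 1) / 2 + n - coxNumDescents cs w) n := by
  have dn : ∀ w, coxNumDescents cs w ≤ n := by
    intro w
    rw [coxNumDescents]
    exact (Finset.card_le_univ _).trans (by simp)
  have nat : ∀ (K : ℕ) (w : W), genBinom ((K : ℝ) + n - coxNumDescents cs w) n =
      ((rmBZ cs K w).card : ℝ) := by
    intro K w
    rw [rmB_count cs (by omega), ← rmB_genBinom_nat]
    congr 1
    rw [Nat.cast_sub (by have := dn w; omega)]
    push_cast; ring
  have half : ∀ k : ℕ, ((2 * (k : ℝ) + 1 - 1) / 2) = k := by intro k; ring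
  choose f hf using fun a b => rmB_genBinom_poly a b n
  have fx : ∀ (x : ℝ) (w : W), genBinom ((x - 1) / 2 + n - coxNumDescents cs w) n =
      (f (1 / 2) (-1 / 2 + n - coxNumDescents cs w)).eval x := by
    intro x w; rw [hf]; congr 1; ring
  have fl : ∀ (x y : ℝ) (w : W), genBinom ((x * y - 1) / 2 + n - coxNumDescents cs w) n =
      (f (x / 2) (-1 / 2 + n - coxNumDescents cs w)).eval y := by
    intro x y w; rw [hf]; congr 1; ring
  have step1 : ∀ (x : ℝ) (k : ℕ),
    ∑ p ∈ Finset.univ.filter (fun p : W × W => p.1 * p.2 = w),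
      genBinom ((x - 1) / 2 + n - coxNumDescents cs p.1) n *
        genBinom ((2 * (k : ℝ) + 1 - 1) / 2 + n - coxNumDescents cs p.2) n =
      genBinom ((x * (2 * (k : ℝ) + 1) - 1) / 2 + n - coxNumDescents cs w) n := by
    intro x k
    have := rmB_poly_ext
      (∑ p ∈ Finset.univ.filter (fun p : W × W => p.1 * p.2 = w),
        f (1 / 2) (-1 / 2 + n - coxNumDescents cs p.1) *
          Polynomial.C (genBinom ((2 * (k : ℝ) + 1 - 1) / 2 + n - coxNumDescents cs p.2) n))
      (f ((2 * (k : ℝ) + 1) / 2) (-1 / 2 + n - coxNumDescents cs w)) ?_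
    · have h := congrArg (Polynomial.eval x) this
      simp only [Polynomial.eval_finset_sum, Polynomial.eval_mul, Polynomial.eval_C, ← fx,
        ← fl] at h
      rw [h, mul_comm x]
    · intro l
      simp only [Polynomial.eval_finset_sum, Polynomial.eval_mul, Polynomial.eval_C, ← fx, ← fl]
      have e : ((2 * (k : ℝ) + 1) * (2 * (l : ℝ) + 1) - 1) / 2 =
        ((2 * k * l + k + l : ℕ) : ℝ) := by push_cast; ring
      simp only [half, e, nat]
      exact_mod_cast rmB_conv_nat cs k l w
  have := rmB_poly_ext
      (∑ p ∈ Finset.univ.filter (fun p : W × W => p.1 * p.2 = w),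
        Polynomial.C (genBinom ((x - 1) / 2 + n - coxNumDescents cs p.1) n) *
        f (1 / 2) (-1 / 2 + n - coxNumDescents cs p.2))
      (f (x / 2) (-1 / 2 + n - coxNumDescents cs w)) ?_
  · have h := congrArg (Polynomial.eval y) this
    simpa only [Polynomial.eval_finset_sum, Polynomial.eval_mul, Polynomial.eval_C, ← fx,
        ← fl] using h
  · intro k
    simp only [Polynomial.eval_finset_sum, Polynomial.eval_mul, Polynomial.eval_C]
    simp only [← fx]
    rw [← fl]
    exact step1 x k


/-- The convolution property `M_{W,x} M_{W,y} = M_{W,xy}` of the type `B`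
riffle shuffle measures `M_{Bₙ,x}(w) = C((x-1)/2 + n - d(w), n) / xⁿ`. -/
theorem riffle_measure_convolution_type_B (n : ℕ) (hn : 2 ≤ n) {W : Type*}
    [Group W] [Fintype W] [DecidableEq W]
    (cs : CoxeterSystem (CoxeterMatrix.Bₙ n) W)
    (x y : ℝ) (hx : x ≠ 0) (hy : y ≠ 0) (w : W) :
    ∑ p ∈ Finset.univ.filter (fun p : W × W => p.1 * p.2 = w),
      (genBinom ((x - 1) / 2 + n - coxNumDescents cs p.1) n / x ^ n) *
        (genBinom ((y - 1) / 2 + n - coxNumDescents cs p.2) n / y ^ n) =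
      genBinom ((x * y - 1) / 2 + n - coxNumDescents cs w) n / (x * y) ^ n := by
  rw [← rmB_real hn cs x y w, mul_pow, Finset.sum_div]
  refine Finset.sum_congr rfl fun p _ => ?_
  rw [div_mul_div_comm]
end

section
/- Let (W,S) be a Coxeter system of type G_2 (two generators s, t with (st) of order 6), so W is the dihedral group of order 12. For a nonzero real number x define f_x : W → ℝ by f_x(w) = (x+5)(x+1)/(12x²) if d(w) = 0, f_x(w) = (x+1)(x−1)/(12x²) if d(w) = 1, and f_x(w) = (x−1)(x−5)/(12x²) if d(w) = 2. Let P be the 12 × 12 real matrix with rows and columns indexed by W whose (u,v) entry is f_x(v u⁻¹). Then the characteristic polynomial of P equals (X − 1)(X − 1/x)^6 (X − 1/x²)^5. -/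
/-- The shuffle measure `M_{G₂,x}` on a Coxeter group of type `G₂`:
`f_x(w) = (x+5)(x+1)/(12x²)`, `(x+1)(x-1)/(12x²)`, `(x-1)(x-5)/(12x²)`
according as `d(w) = 0, 1, 2`. -/
noncomputable def fG2 {W : Type*} [Group W]
    (cs : CoxeterSystem CoxeterMatrix.G₂ W) (x : ℝ) (w : W) : ℝ :=
  if coxNumDescents cs w = 0 then (x + 5) * (x + 1) / (12 * x ^ 2)
  else if coxNumDescents cs w = 1 then (x + 1) * (x - 1) / (12 * x ^ 2)
  else (x - 1) * (x - 5) / (12 * x ^ 2)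


open DihedralGroup in
/-- Images of the two simple reflections in the dihedral group. -/
def g2gen : Fin 2 → DihedralGroup 6 := ![sr 0, sr 1]

/-- A reduced word for every element of the dihedral group of order 12. -/
def g2word : DihedralGroup 6 → List (Fin 2)
  | .r i => (![[], [0, 1], [0, 1, 0, 1], [0, 1, 0, 1, 0, 1], [1, 0, 1, 0], [1, 0]] :
      Fin 6 → List (Fin 2)) i
  | .sr i => (![[0], [1], [1, 0, 1], [1, 0, 1, 0, 1], [0, 1, 0, 1, 0], [0, 1, 0]] :
      Fin 6 → List (Fin 2)) i

theorem g2gen_liftable : CoxeterMatrix.IsLiftable CoxeterMatrix.G₂ g2gen := by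
  unfold CoxeterMatrix.IsLiftable
  decide

theorem g2word_step : ∀ g i, g2word (g * g2gen i) = g2word g ++ [i] ∨
    g2word g = g2word (g * g2gen i) ++ [i] ∨ (g = .r 3 ∧ i = 0) ∨ (g = .sr 3 ∧ i = 0) := by
  decide

theorem g2word_length_mul : ∀ g i, (g2word (g * g2gen i)).length ≤ (g2word g).length + 1 := by
  decide

theorem g2_des : ∀ g : DihedralGroup 6,
    ((Finset.univ.filter fun i : Fin 2 =>
      (g2word (g * g2gen i)).length < (g2word g).length).card = 0 ∧ g = 1) ∨
    ((Finset.univ.filter fun i : Fin 2 =>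
      (g2word (g * g2gen i)).length < (g2word g).length).card = 2 ∧ g = .r 3) ∨
    ((Finset.univ.filter fun i : Fin 2 =>
      (g2word (g * g2gen i)).length < (g2word g).length).card = 1 ∧ g ≠ 1 ∧ g ≠ .r 3) := by
  decide

section
variable {W : Type*} [Group W] (cs : CoxeterSystem CoxeterMatrix.G₂ W)

/-- The homomorphism from the Coxeter group to the dihedral group. -/
noncomputable def g2phi : W →* DihedralGroup 6 := cs.lift ⟨g2gen, g2gen_liftable⟩

theorem g2phi_simple (i : Fin 2) : g2phi cs (cs.simple i) = g2gen i :=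
  cs.lift_apply_simple g2gen_liftable i

/-- The inverse map. -/
noncomputable def g2psi (g : DihedralGroup 6) : W := cs.wordProd (g2word g)

theorem g2word_prod : ∀ g, ((g2word g).map g2gen).prod = g := by decide

theorem g2phi_psi (g : DihedralGroup 6) : g2phi cs (g2psi cs g) = g := by
  conv_rhs => rw [← g2word_prod g]
  unfold g2psi CoxeterSystem.wordProd
  rw [map_list_prod, List.map_map]
  congr 2
  ext i
  exact g2phi_simple cs i

theorem g2psi_mul (g : DihedralGroup 6) (i : Fin 2) :
    g2psi cs (g * g2gen i) = g2psi cs g * cs.simple i := by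
  have hs := cs.simple_mul_simple_self 0
  have ht := cs.simple_mul_simple_self 1
  have hs' : ∀ w, cs.simple 0 * (cs.simple 0 * w) = w := fun w => by
    rw [← mul_assoc, hs, one_mul]
  have ht' : ∀ w, cs.simple 1 * (cs.simple 1 * w) = w := fun w => by
    rw [← mul_assoc, ht, one_mul]
  have h6 : (cs.simple 0 * cs.simple 1) ^ 6 = 1 := cs.simple_mul_simple_pow 0 1
  have h1 : cs.simple 1 * (cs.simple 0 * (cs.simple 1 * (cs.simple 0 * (cs.simple 1 *
      cs.simple 0)))) = cs.simple 0 * (cs.simple 1 * (cs.simple 0 * (cs.simple 1 *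
      (cs.simple 0 * cs.simple 1)))) := by
    have e : (cs.simple 0 * cs.simple 1) ^ 3 = ((cs.simple 0 * cs.simple 1) ^ 3)⁻¹ := by
      rw [eq_inv_iff_mul_eq_one, ← pow_add]; exact h6
    simp only [pow_succ, pow_zero, one_mul, mul_inv_rev, cs.inv_simple, mul_assoc] at e
    exact e.symm
  have h2 : cs.simple 0 * (cs.simple 1 * (cs.simple 0 * (cs.simple 1 * (cs.simple 0 *
      (cs.simple 1 * cs.simple 0))))) = cs.simple 1 * (cs.simple 0 * (cs.simple 1 *
      (cs.simple 0 * cs.simple 1))) := by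
    rw [h1, hs']
  unfold g2psi
  rcases g2word_step g i with h | h | ⟨rfl, rfl⟩ | ⟨rfl, rfl⟩
  · rw [h, cs.wordProd_append, cs.wordProd_singleton]
  · rw [h, cs.wordProd_append, cs.wordProd_singleton, mul_assoc, cs.simple_mul_simple_self,
      mul_one]
  · have e1 : g2word (.r 3 * g2gen 0) = [1, 0, 1, 0, 1] := by decide
    have e2 : g2word (.r 3) = [0, 1, 0, 1, 0, 1] := by decide
    rw [e1, e2]
    simp only [CoxeterSystem.wordProd, List.map_cons, List.map_nil, List.prod_cons,
      List.prod_nil, mul_one, mul_assoc, h2]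
  · have e1 : g2word (.sr 3 * g2gen 0) = [0, 1, 0, 1, 0, 1] := by decide
    have e2 : g2word (.sr 3) = [1, 0, 1, 0, 1] := by decide
    rw [e1, e2]
    simp only [CoxeterSystem.wordProd, List.map_cons, List.map_nil, List.prod_cons,
      List.prod_nil, mul_one, mul_assoc, h1]

theorem g2psi_phi (w : W) : g2psi cs (g2phi cs w) = w := by
  induction w using cs.simple_induction_right with
  | one => rw [map_one]; exact cs.wordProd_nil
  | mul_simple_right w i ih => rw [map_mul, g2phi_simple, g2psi_mul, ih]

theorem g2_length (w : W) : cs.length w = (g2word (g2phi cs w)).length := by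
  apply le_antisymm
  · conv_lhs => rw [← g2psi_phi cs w]
    exact cs.length_wordProd_le _
  · obtain ⟨ω, hω, rfl⟩ := cs.exists_isReduced w
    rw [hω.eq]
    clear hω
    induction ω using List.reverseRecOn with
    | nil => simp [show g2word 1 = [] from rfl]
    | append_singleton ω i ih =>
      rw [cs.wordProd_append, cs.wordProd_singleton, map_mul, g2phi_simple, List.length_append]
      exact (g2word_length_mul _ i).trans (Nat.add_le_add_right ih 1)

theorem g2_numDescents (w : W) : coxNumDescents cs w = (Finset.univ.filter fun i : Fin 2 =>
    (g2word (g2phi cs w * g2gen i)).length < (g2word (g2phi cs w)).length).card := by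
  unfold coxNumDescents
  simp only [g2_length, map_mul, g2phi_simple]

theorem g2_fG2 (x : ℝ) (w : W) : fG2 cs x w =
    if g2phi cs w = 1 then (x + 5) * (x + 1) / (12 * x ^ 2)
    else if g2phi cs w = .r 3 then (x - 1) * (x - 5) / (12 * x ^ 2)
    else (x + 1) * (x - 1) / (12 * x ^ 2) := by
  unfold fG2
  rw [g2_numDescents]
  rcases g2_des (g2phi cs w) with ⟨h, h'⟩ | ⟨h, h'⟩ | ⟨h, h1, h2⟩
  · rw [h, h']; simp
  · rw [h, h']; simp [show (DihedralGroup.r 3 : DihedralGroup 6) ≠ 1 by decide]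
  · simp [h, h1, h2]

/-- The group isomorphism, as an equivalence. -/
noncomputable def g2equiv : W ≃ DihedralGroup 6 where
  toFun := g2phi cs
  invFun := g2psi cs
  left_inv := g2psi_phi cs
  right_inv := g2phi_psi cs
end

/-- Enumeration of the dihedral group by pairs of opposite elements. -/
def g2enum : Fin 6 ⊕ Fin 6 → DihedralGroup 6
  | .inl i => (![.r 0, .r 1, .r 2, .sr 0, .sr 1, .sr 2] : Fin 6 → DihedralGroup 6) i
  | .inr i => (![.r 3, .r 4, .r 5, .sr 3, .sr 4, .sr 5] : Fin 6 → DihedralGroup 6) i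

theorem g2enum_bij : Function.Bijective g2enum := by decide

theorem g2enum_diag : ∀ i j : Fin 6,
    (g2enum (.inl j) * (g2enum (.inl i))⁻¹ = 1 ↔ i = j) ∧
    (g2enum (.inl j) * (g2enum (.inl i))⁻¹ ≠ .r 3) ∧
    (g2enum (.inr j) * (g2enum (.inr i))⁻¹ = 1 ↔ i = j) ∧
    (g2enum (.inr j) * (g2enum (.inr i))⁻¹ ≠ .r 3) ∧
    (g2enum (.inr j) * (g2enum (.inl i))⁻¹ = .r 3 ↔ i = j) ∧
    (g2enum (.inr j) * (g2enum (.inl i))⁻¹ ≠ 1) ∧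
    (g2enum (.inl j) * (g2enum (.inr i))⁻¹ = .r 3 ↔ i = j) ∧
    (g2enum (.inl j) * (g2enum (.inr i))⁻¹ ≠ 1) := by decide

theorem charpoly_blocks_symm {n : Type*} [Fintype n] [DecidableEq n] (A B : Matrix n n ℝ) :
    (Matrix.fromBlocks A B B A).charpoly = (A - B).charpoly * (A + B).charpoly := by
  rw [← Matrix.charpoly_fromBlocks_zero₂₁ (A - B) B (A + B)]
  have e1 : Matrix.fromBlocks (A - B) B 0 (A + B) =
      (Matrix.fromBlocks 1 0 1 1 * Matrix.fromBlocks A B B A) *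
        Matrix.fromBlocks 1 0 (-1) 1 := by
    simp [Matrix.fromBlocks_multiply, sub_eq_add_neg, add_comm]
    abel
  have e2 : (Matrix.fromBlocks 1 0 (-1) 1 : Matrix (n ⊕ n) (n ⊕ n) ℝ) *
      Matrix.fromBlocks 1 0 1 1 = 1 := by
    simp [Matrix.fromBlocks_multiply]
  rw [e1, Matrix.charpoly_mul_comm, ← mul_assoc, e2, one_mul]

theorem charpoly_scalar_add_const (a c : ℝ) :
    (Matrix.of fun i j : Fin 6 => (if i = j then a else 0) + c).charpoly =
      (Polynomial.X - Polynomial.C (a + 6 * c)) * (Polynomial.X - Polynomial.C a) ^ 5 := by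
  have h : (Matrix.of fun i j : Fin 6 => (if i = j then a else 0) + c) =
      Matrix.vecMulVec (fun _ => c) (fun _ => 1) - Matrix.scalar (Fin 6) (-a) := by
    ext i j
    by_cases hij : i = j <;> simp [hij, Matrix.vecMulVec_apply, add_comm]
  rw [h, Matrix.charpoly_sub_scalar, Matrix.charpoly_vecMulVec]
  simp [dotProduct, Polynomial.smul_eq_C_mul]
  ring

/-- The characteristic polynomial of the transition matrix of the `G₂` shuffle
walk equals `(X - 1)(X - 1/x)⁶(X - 1/x²)⁵`. -/
theorem charpoly_shuffle_transition_matrix_G2 {W : Type*} [Group W] [Fintype W]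
    [DecidableEq W] (cs : CoxeterSystem CoxeterMatrix.G₂ W)
    (x : ℝ) (hx : x ≠ 0)
    (P : Matrix W W ℝ) (hP : ∀ u v : W, P u v = fG2 cs x (v * u⁻¹)) :
    P.charpoly = (Polynomial.X - Polynomial.C (1 : ℝ)) *
      (Polynomial.X - Polynomial.C (1 / x)) ^ 6 *
      (Polynomial.X - Polynomial.C (1 / x ^ 2)) ^ 5 := by
  
  set a : ℝ := (x + 5) * (x + 1) / (12 * x ^ 2) with ha
  set b : ℝ := (x - 1) * (x - 5) / (12 * x ^ 2) with hb
  set c : ℝ := (x + 1) * (x - 1) / (12 * x ^ 2) with hc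
  let e : W ≃ Fin 6 ⊕ Fin 6 := (g2equiv cs).trans (Equiv.ofBijective g2enum g2enum_bij).symm
  have he : ∀ k, g2phi cs (e.symm k) = g2enum k := fun k => g2phi_psi cs _
  let A : Matrix (Fin 6) (Fin 6) ℝ := Matrix.of fun i j => if i = j then a else c
  let B : Matrix (Fin 6) (Fin 6) ℝ := Matrix.of fun i j => if i = j then b else c
  have hR : Matrix.reindex e e P = Matrix.fromBlocks A B B A := by
    ext i j
    rw [Matrix.reindex_apply, Matrix.submatrix_apply, hP, g2_fG2, map_mul, map_inv, he, he]
    rcases i with i | i <;> rcases j with j | j <;>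
      obtain ⟨h1, h2, h3, h4, h5, h6, h7, h8⟩ := g2enum_diag i j
    · simp only [h1, h2, if_false, Matrix.fromBlocks_apply₁₁]; rfl
    · simp only [h5, h6, if_false, Matrix.fromBlocks_apply₁₂]; rfl
    · simp only [h7, h8, if_false, Matrix.fromBlocks_apply₂₁]; rfl
    · simp only [h3, h4, if_false, Matrix.fromBlocks_apply₂₂]; rfl
  have hsub : A - B = Matrix.of fun i j : Fin 6 => (if i = j then 1 / x else 0) + 0 := by
    ext i j
    by_cases hij : i = j
    · simp only [A, B, Matrix.sub_apply, Matrix.of_apply, hij, if_true, ha, hb]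
      field_simp
      ring
    · simp [A, B, hij]
  have hadd : A + B = Matrix.of fun i j : Fin 6 =>
      (if i = j then 1 / x ^ 2 else 0) + (x ^ 2 - 1) / (6 * x ^ 2) := by
    ext i j
    by_cases hij : i = j
    · simp only [A, B, Matrix.add_apply, Matrix.of_apply, hij, if_true, ha, hb]
      field_simp
      ring
    · simp only [A, B, Matrix.add_apply, Matrix.of_apply, hij, if_false, hc]
      field_simp
      ring
  have h1 : 1 / x ^ 2 + 6 * ((x ^ 2 - 1) / (6 * x ^ 2)) = 1 := by
    field_simp
    ring
  rw [← Matrix.charpoly_reindex e P, hR, charpoly_blocks_symm, hsub, hadd,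
    charpoly_scalar_add_const, charpoly_scalar_add_const, h1, mul_zero, add_zero]
  ring
end
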